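/- arXiv:1408.0757 — 4 statements merged into one kernel-verified Lean document; each statement's English description precedes it below -/
import Mathlib

section
/- Let a = 0.3637. Then for every N ≥ 2 and every minimum-energy configuration (x*_1,…,x*_N) for the cut-off Lennard-Jones potential V_a, the minimal interparticle distance satisfies min_{1≤i<j≤N} |x*_i − x*_j| ≥ 0.44. -/
open MeasureTheory Real

noncomputable section

abbrev E3 := EuclideanSpace ℝ (Fin 3)

/-- Lennard-Jones potential -/
def VLJ (r : ℝ) : ℝ := 1 / r ^ 12 - 2 / r ^ 6

/-- cut-off Lennard-Jones potential -/
def Va (a r : ℝ) : ℝ := if a < r then VLJ r else VLJ a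

/-- configurational energy of N particles -/
def pairEnergy (V : ℝ → ℝ) {N : ℕ} (x : Fin N → E3) : ℝ :=
  ∑ p ∈ Finset.univ.filter (fun p : Fin N × Fin N => p.1 < p.2), V ‖x p.1 - x p.2‖

/-- stability with constant B -/
def IsStableWith (V : ℝ → ℝ) (B : ℝ) : Prop :=
  0 ≤ B ∧ ∀ (N : ℕ) (x : Fin N → E3), -(B * N) ≤ pairEnergy V x

/-- stability constant: infimum of admissible stability constants -/
def stabConst (V : ℝ → ℝ) : ℝ := sInf {B | IsStableWith V B}

def IsMinEnergy (V : ℝ → ℝ) {N : ℕ} (x : Fin N → E3) : Prop :=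
  ∀ y : Fin N → E3, pairEnergy V x ≤ pairEnergy V y

def IsTempered (V : ℝ → ℝ) : Prop :=
  ∃ r₀ : ℝ, 0 ≤ r₀ ∧ IntegrableOn (fun x : E3 => |V ‖x‖|) {x | r₀ ≤ ‖x‖}

open scoped Classical in
/-- n-th Mayer coefficient -/
def mayerCoeff (V : ℝ → ℝ) (β : ℝ) (Λ : Set E3) (n : ℕ) : ℝ :=
  (volume Λ).toReal⁻¹ * (n.factorial : ℝ)⁻¹ *
    ∫ x : Fin n → E3 in Set.univ.pi fun _ => Λ,
      ∑ g ∈ Finset.univ.filter (fun g : SimpleGraph (Fin n) => g.Connected),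
        ∏ e ∈ Finset.univ.filter (fun e : Sym2 (Fin n) => e ∈ g.edgeSet),
          Sym2.lift ⟨fun i j => Real.exp (-β * V ‖x i - x j‖) - 1,
            fun i j => by simp only [norm_sub_rev (x i)]⟩ e

/-- indices of the particles in the closed cube of side `1/4` with lowest corner `l` -/
def cubeIndices {N : ℕ} (x : Fin N → E3) (l : Fin 3 → ℝ) : Finset (Fin N) :=
  Finset.univ.filter fun j => ∀ c, l c ≤ x j c ∧ x j c ≤ l c + 1 / 4

lemma exists_max_cubeIndices {N : ℕ} (x : Fin N → E3) :
    ∃ l, ∀ l', (cubeIndices x l').card ≤ (cubeIndices x l).card := by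
  have hfin : (Set.range fun l => (cubeIndices x l).card).Finite :=
    (Set.finite_Iic N).subset (by
      rintro _ ⟨l, rfl⟩
      simpa using Finset.card_le_univ (cubeIndices x l))
  obtain ⟨_, ⟨l, rfl⟩, hl⟩ := Set.exists_max_image _ id hfin (Set.range_nonempty _)
  exact ⟨l, fun l' => hl _ ⟨l', rfl⟩⟩

lemma norm_sub_le_of_mem_cubeIndices {N : ℕ} {x : Fin N → E3} {l : Fin 3 → ℝ} {i j : Fin N}
    (hi : i ∈ cubeIndices x l) (hj : j ∈ cubeIndices x l) : ‖x i - x j‖ ≤ 0.44 := by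
  simp only [cubeIndices, Finset.mem_filter, Finset.mem_univ, true_and] at hi hj
  have hc : ∀ c, (x i c - x j c) ^ 2 ≤ 1 / 16 := fun c => by
    obtain ⟨h1, h2⟩ := hi c
    obtain ⟨h3, h4⟩ := hj c
    nlinarith
  apply le_of_sq_le_sq _ (by norm_num)
  rw [EuclideanSpace.real_norm_sq_eq, Fin.sum_univ_three]
  simp only [PiLp.sub_apply]
  linarith [hc 0, hc 1, hc 2]

lemma Va_ge_of_le {r : ℝ} (hr : r ≤ 0.44) : 18000 ≤ Va 0.3637 r := by
  unfold Va VLJ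
  split_ifs with h
  · have h0 : 0 < r := by linarith
    have h6 : r ^ 6 ≤ 0.44 ^ 6 := by gcongr
    have ht : 137 ≤ 1 / r ^ 6 := by
      rw [le_div_iff₀ (by positivity)]
      norm_num at h6 ⊢
      linarith
    have : 1 / r ^ 12 - 2 / r ^ 6 = (1 / r ^ 6) ^ 2 - 2 * (1 / r ^ 6) := by
      field_simp
    rw [this]
    nlinarith
  · norm_num

lemma lennardJones_polynomial_bound {u : ℝ} (hu : 0 < u) :
    (2 * u ^ 3 - 1) * (1 + u / 3) ^ 3 ≤ 2.5 * u ^ 6 := by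
  nlinarith [sq_nonneg (u ^ 3 - u), sq_nonneg (u ^ 3 - u ^ 2), sq_nonneg (u ^ 3 - 1),
    sq_nonneg (u ^ 2 - 1),
    sq_nonneg (u - 1), mul_pos hu hu, pow_pos hu 3, pow_pos hu 5,
    mul_nonneg hu.le (sq_nonneg (u - 1)), mul_nonneg hu.le (sq_nonneg (u ^ 2 - u))]

lemma neg_Va_le (r : ℝ) : -Va 0.3637 r ≤ 2.5 / (1 + r ^ 2 / 3) ^ 3 := by
  unfold Va VLJ
  split_ifs with h
  · have h0 : 0 < r := by linarith
    have := lennardJones_polynomial_bound (u := r ^ 2) (by positivity)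
    rw [le_div_iff₀ (by positivity)]
    have e : -(1 / r ^ 12 - 2 / r ^ 6) = (2 * (r ^ 2) ^ 3 - 1) / (r ^ 2) ^ 6 := by
      field_simp
      ring
    rw [e, div_mul_eq_mul_div, div_le_iff₀ (by positivity)]
    exact this
  · have : (0 : ℝ) ≤ 2.5 / (1 + r ^ 2 / 3) ^ 3 := by positivity
    refine le_trans ?_ this
    norm_num

lemma mul_mul_one_add_le {a b c : ℝ} (ha : 0 ≤ a) (hb : 0 ≤ b) (hc : 0 ≤ c) :
    (1 + a) * (1 + b) * (1 + c) ≤ (1 + (a + b + c) / 3) ^ 3 := by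
  nlinarith [mul_nonneg ha (sq_nonneg (b - c)), mul_nonneg hb (sq_nonneg (a - c)),
    mul_nonneg hc (sq_nonneg (a - b)), mul_nonneg ha (sq_nonneg (a - b)),
    mul_nonneg ha (sq_nonneg (a - c)), mul_nonneg hb (sq_nonneg (a - b)),
    mul_nonneg hb (sq_nonneg (b - c)), mul_nonneg hc (sq_nonneg (a - c)),
    mul_nonneg hc (sq_nonneg (b - c)), sq_nonneg (a - b), sq_nonneg (b - c), sq_nonneg (a - c)]

/-- upper bound for `1 / (1 + y ^ 2)` on `m / 4 ≤ |y|` -/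
def shellWeight (m : ℕ) : ℝ := 16 / (16 + (m : ℝ) ^ 2)

lemma shellWeight_nonneg (m : ℕ) : 0 ≤ shellWeight m := by
  unfold shellWeight; positivity

lemma sum_shellWeight_le (M : ℕ) : ∑ m ∈ Finset.range M, shellWeight m ≤ 7.5 := by
  have key : ∀ n : ℕ, ∑ m ∈ Finset.range (n + 5), shellWeight m ≤ 7.5 - 16 / (n + 4.5) := by
    intro n
    induction n with
    | zero => norm_num [Finset.sum_range_succ, shellWeight]
    | succ n ih =>
      rw [show n + 1 + 5 = n + 5 + 1 by ring, Finset.sum_range_succ]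
      have : shellWeight (n + 5) ≤ 16 / ((n : ℝ) + 4.5) - 16 / ((n : ℝ) + 1 + 4.5) := by
        unfold shellWeight
        rw [div_sub_div _ _ (by positivity) (by positivity),
          div_le_div_iff₀ (by positivity) (by positivity)]
        push_cast
        nlinarith
      push_cast
      linarith
  calc ∑ m ∈ Finset.range M, shellWeight m
      ≤ ∑ m ∈ Finset.range (M + 5), shellWeight m :=
        Finset.sum_le_sum_of_subset_of_nonneg (Finset.range_mono (by omega))
          fun m _ _ => shellWeight_nonneg m
    _ ≤ 7.5 - 16 / (M + 4.5) := key M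
    _ ≤ 7.5 := by
      have : (0 : ℝ) ≤ 16 / (M + 4.5) := by positivity
      linarith

/-- sign and magnitude, in units of `1/4`, of a coordinate -/
def cellIndex (t : ℝ) : Bool × ℕ := (decide (0 ≤ t), ⌊4 * |t|⌋₊)

/-- lower end of the closed interval of length `1/4` with the given index -/
def cellCorner (b : Bool × ℕ) : ℝ := if b.1 then b.2 / 4 else -((b.2 : ℝ) + 1) / 4

lemma mem_cell (t : ℝ) :
    cellCorner (cellIndex t) ≤ t ∧ t ≤ cellCorner (cellIndex t) + 1 / 4 := by
  have h1 := Nat.floor_le (show 0 ≤ 4 * |t| by positivity)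
  have h2 := Nat.lt_floor_add_one (4 * |t|)
  unfold cellCorner cellIndex
  rcases le_or_gt 0 t with h | h
  · rw [abs_of_nonneg h] at *
    simp only [h, decide_true, if_true]
    constructor <;> linarith
  · rw [abs_of_neg h] at *
    simp only [not_le.mpr h, decide_false, Bool.false_eq_true, if_false]
    constructor <;> linarith

lemma inv_one_add_sq_le_shellWeight (t : ℝ) :
    1 / (1 + t ^ 2) ≤ shellWeight (cellIndex t).2 := by
  have h1 := Nat.floor_le (show 0 ≤ 4 * |t| by positivity)
  have h2 : ((⌊4 * |t|⌋₊ : ℕ) : ℝ) ^ 2 ≤ (4 * |t|) ^ 2 := by gcongr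
  rw [mul_pow, sq_abs] at h2
  simp only [shellWeight, cellIndex]
  rw [div_le_div_iff₀ (by positivity) (by positivity)]
  linarith

lemma neg_Va_norm_le_prod (y : E3) :
    -Va 0.3637 ‖y‖ ≤ 2.5 * ∏ c, shellWeight (cellIndex (y c)).2 := by
  have hn : ‖y‖ ^ 2 = y 0 ^ 2 + y 1 ^ 2 + y 2 ^ 2 := by
    rw [EuclideanSpace.real_norm_sq_eq, Fin.sum_univ_three]
  calc -Va 0.3637 ‖y‖ ≤ 2.5 / (1 + ‖y‖ ^ 2 / 3) ^ 3 := neg_Va_le _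
    _ ≤ 2.5 / ((1 + y 0 ^ 2) * (1 + y 1 ^ 2) * (1 + y 2 ^ 2)) := by
      rw [hn]
      gcongr
      exact mul_mul_one_add_le (sq_nonneg _) (sq_nonneg _) (sq_nonneg _)
    _ = 2.5 * ∏ c, 1 / (1 + y c ^ 2) := by
      rw [Fin.prod_univ_three]
      field_simp
    _ ≤ 2.5 * ∏ c, shellWeight (cellIndex (y c)).2 := by
      gcongr
      exact inv_one_add_sq_le_shellWeight _

lemma sum_prod_shellWeight_le {N : ℕ} {x : Fin N → E3} {n : ℕ}
    (hn : ∀ l, (cubeIndices x l).card ≤ n) (p : E3) :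
    ∑ j, ∏ c, shellWeight (cellIndex ((x j - p) c)).2 ≤ 3375 * n := by
  obtain ⟨M, hM⟩ : ∃ M, ∀ j c, (cellIndex ((x j - p) c)).2 < M := by
    refine ⟨(Finset.univ.sup fun q : Fin N × Fin 3 => (cellIndex ((x q.1 - p) q.2)).2) + 1,
      fun j c => Nat.lt_succ_of_le ?_⟩
    exact Finset.le_sup (f := fun q : Fin N × Fin 3 => (cellIndex ((x q.1 - p) q.2)).2)
      (Finset.mem_univ (j, c))
  set B : Finset (Bool × ℕ) := Finset.univ ×ˢ Finset.range M
  set T : Finset (Fin 3 → Bool × ℕ) := Fintype.piFinset fun _ => B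
  have hmaps : ∀ j ∈ (Finset.univ : Finset (Fin N)),
      (fun c => cellIndex ((x j - p) c)) ∈ T := by
    intro j _
    simp only [T, B, Fintype.mem_piFinset, Finset.mem_product, Finset.mem_univ, true_and,
      Finset.mem_range]
    exact hM j
  have hB : ∑ b ∈ B, shellWeight b.2 ≤ 15 := by
    rw [Finset.sum_product]
    simp only [Fintype.sum_bool]
    linarith [sum_shellWeight_le M]
  have hB0 : 0 ≤ ∑ b ∈ B, shellWeight b.2 := Finset.sum_nonneg fun b _ => shellWeight_nonneg _
  rw [← Finset.sum_fiberwise_of_maps_to hmaps]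
  calc _ ≤ ∑ z ∈ T, n * ∏ c, shellWeight (z c).2 := by
        refine Finset.sum_le_sum fun z _ => ?_
        have hprod : 0 ≤ ∏ c, shellWeight (z c).2 :=
          Finset.prod_nonneg fun c _ => shellWeight_nonneg _
        have hsub : (Finset.univ.filter fun j => (fun c => cellIndex ((x j - p) c)) = z) ⊆
            cubeIndices x fun c => p c + cellCorner (z c) := by
          intro j hj
          obtain rfl := (Finset.mem_filter.mp hj).2
          simp only [cubeIndices, Finset.mem_filter, Finset.mem_univ, true_and]
          intro c
          have := mem_cell ((x j - p) c)
          simp only [PiLp.sub_apply] at this ⊢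
          constructor <;> linarith
        calc _ = ∑ j ∈ Finset.univ.filter (fun j => (fun c => cellIndex ((x j - p) c)) = z),
              ∏ c, shellWeight (z c).2 := by
              refine Finset.sum_congr rfl fun j hj => ?_
              obtain rfl := (Finset.mem_filter.mp hj).2
              rfl
          _ ≤ _ := by
              rw [Finset.sum_const, nsmul_eq_mul]
              gcongr
              exact (Finset.card_le_card hsub).trans (hn _)
    _ = n * ∏ _c : Fin 3, ∑ b ∈ B, shellWeight b.2 := by
        rw [← Finset.mul_sum, Finset.prod_univ_sum]
    _ ≤ n * ∏ _c : Fin 3, (15 : ℝ) := by gcongr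
    _ = 3375 * n := by norm_num; ring

lemma pairEnergy_eq_add_sum_erase (V : ℝ → ℝ) {N : ℕ} (x : Fin N → E3) (i : Fin N) :
    pairEnergy V x = (∑ q ∈ Finset.univ.filter (fun q : Fin N × Fin N =>
        q.1 < q.2 ∧ q.1 ≠ i ∧ q.2 ≠ i), V ‖x q.1 - x q.2‖) +
      ∑ j ∈ Finset.univ.erase i, V ‖x i - x j‖ := by
  unfold pairEnergy
  rw [← Finset.sum_filter_add_sum_filter_not _ (fun q : Fin N × Fin N => q.1 ≠ i ∧ q.2 ≠ i),
    Finset.filter_filter, Finset.filter_filter]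
  congr 1
  symm
  refine Finset.sum_bij (fun j _ => if j < i then (j, i) else (i, j)) ?_ ?_ ?_ ?_
  · intro j hj
    have := Finset.ne_of_mem_erase hj
    simp only [Finset.mem_filter, Finset.mem_univ, true_and]
    split_ifs with h
    · simp [h]
    · simp [lt_of_le_of_ne (not_lt.mp h) this.symm]
  · intro j hj k hk h
    have := Finset.ne_of_mem_erase hj
    have := Finset.ne_of_mem_erase hk
    grind
  · rintro ⟨a, b⟩ h
    simp only [Finset.mem_filter, Finset.mem_univ, true_and] at h
    obtain ⟨hab, h⟩ := h
    by_cases ha : a = i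
    · subst ha
      exact ⟨b, by simp [hab.ne'], by simp [hab.not_gt]⟩
    · have hb : b = i := by tauto
      subst hb
      exact ⟨a, by simp [hab.ne], by simp [hab]⟩
  · intro j _
    split_ifs with h
    · rw [norm_sub_rev]
    · rfl

lemma Va_nonpos_of_one_le {r : ℝ} (hr : 1 ≤ r) : Va 0.3637 r ≤ 0 := by
  have h : (0.3637 : ℝ) < r := by linarith
  have h6 : 1 ≤ r ^ 6 := one_le_pow₀ hr
  rw [Va, if_pos h, VLJ, sub_nonpos, div_le_div_iff₀ (by positivity) (by positivity)]
  nlinarith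

lemma sum_Va_nonpos {N : ℕ} {x : Fin N → E3} (hx : IsMinEnergy (Va 0.3637) x) (i : Fin N) :
    ∑ j ∈ Finset.univ.erase i, Va 0.3637 ‖x i - x j‖ ≤ 0 := by
  set p : E3 := EuclideanSpace.single 0 (1 + ∑ j, ‖x j‖)
  have hp : ‖p‖ = 1 + ∑ j, ‖x j‖ := by
    rw [PiLp.norm_single, Real.norm_of_nonneg (by positivity)]
  have hfar : ∀ j, 1 ≤ ‖p - x j‖ := fun j => by
    have h1 := norm_sub_norm_le p (x j)
    have h2 := Finset.single_le_sum (f := fun j => ‖x j‖) (fun k _ => norm_nonneg _)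
      (Finset.mem_univ j)
    linarith
  have hmin := hx (Function.update x i p)
  rw [pairEnergy_eq_add_sum_erase _ x i, pairEnergy_eq_add_sum_erase _ _ i] at hmin
  have hrest : (∑ q ∈ Finset.univ.filter (fun q : Fin N × Fin N =>
        q.1 < q.2 ∧ q.1 ≠ i ∧ q.2 ≠ i),
        Va 0.3637 ‖Function.update x i p q.1 - Function.update x i p q.2‖) =
      ∑ q ∈ Finset.univ.filter (fun q : Fin N × Fin N =>
        q.1 < q.2 ∧ q.1 ≠ i ∧ q.2 ≠ i), Va 0.3637 ‖x q.1 - x q.2‖ := by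
    refine Finset.sum_congr rfl fun q hq => ?_
    obtain ⟨-, h1, h2⟩ := (Finset.mem_filter.mp hq).2
    rw [Function.update_of_ne h1, Function.update_of_ne h2]
  have hmoved : ∑ j ∈ Finset.univ.erase i,
      Va 0.3637 ‖Function.update x i p i - Function.update x i p j‖ ≤ 0 := by
    refine Finset.sum_nonpos fun j hj => ?_
    rw [Function.update_self, Function.update_of_ne (Finset.ne_of_mem_erase hj)]
    exact Va_nonpos_of_one_le (hfar j)
  linarith

lemma card_close_le {N : ℕ} {x : Fin N → E3} {n : ℕ} (hn : ∀ l, (cubeIndices x l).card ≤ n)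
    (hx : IsMinEnergy (Va 0.3637) x) (i : Fin N) (s : Finset (Fin N))
    (hs : ∀ j ∈ s, j ≠ i ∧ ‖x i - x j‖ ≤ 0.44) :
    18000 * (s.card : ℝ) ≤ 8437.5 * n := by
  have hpoint : ∀ j, (if j ∈ s then 18000 else 0) -
      2.5 * ∏ c, shellWeight (cellIndex ((x j - x i) c)).2 ≤ Va 0.3637 ‖x i - x j‖ := by
    intro j
    have hw : 0 ≤ ∏ c, shellWeight (cellIndex ((x j - x i) c)).2 :=
      Finset.prod_nonneg fun c _ => shellWeight_nonneg _
    split_ifs with h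
    · linarith [Va_ge_of_le (hs j h).2]
    · have := neg_Va_norm_le_prod (x j - x i)
      rw [norm_sub_rev] at this
      linarith
  have hsum := (Finset.sum_le_sum fun j (_ : j ∈ Finset.univ.erase i) => hpoint j).trans
    (sum_Va_nonpos hx i)
  have hsub : s ⊆ Finset.univ.erase i := fun j hj => by simpa using (hs j hj).1
  rw [Finset.sum_sub_distrib, ← Finset.mul_sum, Finset.sum_ite_mem,
    Finset.inter_eq_right.mpr hsub, Finset.sum_const, nsmul_eq_mul] at hsum
  have hle : ∑ j ∈ Finset.univ.erase i, ∏ c, shellWeight (cellIndex ((x j - x i) c)).2 ≤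
      3375 * n :=
    (Finset.sum_le_sum_of_subset_of_nonneg (Finset.erase_subset _ _) fun j _ _ =>
      Finset.prod_nonneg fun c _ => shellWeight_nonneg _).trans (sum_prod_shellWeight_le hn (x i))
  linarith

/-- for `a = 0.3637`, in any minimum-energy configuration of `N ≥ 2`
particles for `V_a`, the minimal interparticle distance is at least `0.44`. -/
theorem stmt2 (N : ℕ) (hN : 2 ≤ N) (x : Fin N → E3)
    (hx : IsMinEnergy (Va 0.3637) x) :
    ∀ i j : Fin N, i ≠ j → (0.44 : ℝ) ≤ ‖x i - x j‖ := by
  intro i j hij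
  by_contra! hlt
  obtain ⟨l, hl⟩ := exists_max_cubeIndices x
  have hclose : ∀ k, ∀ s : Finset (Fin N), (∀ j ∈ s, j ≠ k ∧ ‖x k - x j‖ ≤ 0.44) →
      18000 * (s.card : ℝ) ≤ 8437.5 * (cubeIndices x l).card := fun k s hs =>
    card_close_le hl hx k s hs
  rcases Nat.lt_or_ge (cubeIndices x l).card 2 with h1 | h2
  · have h := hclose i {j} (by simpa using ⟨hij.symm, hlt.le⟩)
    have h1' : ((cubeIndices x l).card : ℝ) ≤ 1 := by exact_mod_cast Nat.lt_succ_iff.mp h1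
    simp only [Finset.card_singleton, Nat.cast_one] at h
    linarith
  · obtain ⟨k, hk⟩ : (cubeIndices x l).Nonempty := Finset.card_pos.mp (by omega)
    have h := hclose k ((cubeIndices x l).erase k) fun j hj =>
      ⟨Finset.ne_of_mem_erase hj, norm_sub_le_of_mem_cubeIndices hk (Finset.mem_of_mem_erase hj)⟩
    rw [Finset.card_erase_of_mem hk, Nat.cast_sub (by omega)] at h
    have h2' : (2 : ℝ) ≤ (cubeIndices x l).card := by exact_mod_cast h2
    push_cast at h
    linarith

end
end

section
/- (Penrose–Ruelle) Let V be a measurable pair potential on (0,∞) that is stable with constant B ≥ 0 and tempered. Then for every β > 0, every bounded measurable Λ ⊂ ℝ³ of positive volume, and every n ≥ 2, the n-th Mayer coefficient satisfies |C_n(β,Λ)| ≤ e^{2βB(n−1)} · n^{n−2} · C(β)^{n−1} / n!, where C(β) = ∫_{ℝ³} |e^{−βV(|x|)} − 1| dx. -/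
open MeasureTheory Real

noncomputable section

section GraphSums

open Finset

variable {ι R : Type*}

/-- All edges of `g` have both endpoints in `A`. -/
def SimpleGraph.SupportedIn (g : SimpleGraph ι) (A : Finset ι) : Prop :=
  ∀ i j, g.Adj i j → i ∈ A ∧ j ∈ A

open scoped Classical in
/-- The product of the edge weights of a graph. -/
def graphWeight [Fintype ι] [CommRing R] (w : Sym2 ι → R) (g : SimpleGraph ι) : R :=
  ∏ e ∈ univ.filter (fun e : Sym2 ι => e ∈ g.edgeSet), w e

/-- Every vertex of `Y` is joined to a vertex of `X` by a path of `g`. -/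
def SimpleGraph.Reaches (g : SimpleGraph ι) (X Y : Finset ι) : Prop :=
  ∀ y ∈ Y, ∃ x ∈ X, g.Reachable x y

open scoped Classical in
/-- The weighted sum over graphs on `X ∪ Y` each of whose components meets `X`. -/
def rootedSum [Fintype ι] [DecidableEq ι] [CommRing R] (w : Sym2 ι → R) (X Y : Finset ι) : R :=
  ∑ g ∈ univ.filter (fun g : SimpleGraph ι => g.SupportedIn (X ∪ Y) ∧ g.Reaches X Y),
    graphWeight w g

open scoped Classical in
/-- The weighted sum over all graphs on `A`, in product form. -/
def fullWeight [CommRing R] (w : Sym2 ι → R) (A : Finset ι) : R :=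
  ∏ e ∈ A.sym2.filter (fun e => ¬ e.IsDiag), (1 + w e)

open scoped Classical in
theorem fullWeight_eq_sum [Fintype ι] [CommRing R] (w : Sym2 ι → R) (A : Finset ι) :
    fullWeight w A =
      ∑ g ∈ univ.filter (fun g : SimpleGraph ι => g.SupportedIn A), graphWeight w g := by
  rw [fullWeight, prod_one_add]
  symm
  refine sum_nbij' (fun g => univ.filter (fun e : Sym2 ι => e ∈ g.edgeSet))
    (fun t => SimpleGraph.fromEdgeSet (t : Set (Sym2 ι))) ?_ ?_ ?_ ?_ ?_
  · intro g hg
    simp only [mem_filter, mem_univ, true_and] at hg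
    rw [mem_powerset]
    intro e
    induction e using Sym2.ind with
    | _ i j =>
      intro h
      simp only [mem_filter, mem_univ, true_and, SimpleGraph.mem_edgeSet] at h
      simpa [h.ne] using hg i j h
  · intro t ht
    simp only [mem_filter, mem_univ, true_and]
    intro i j h
    simp only [SimpleGraph.fromEdgeSet_adj, mem_coe] at h
    have := mem_powerset.1 ht h.1
    simpa [h.2] using this
  · intro g _
    ext i j
    simp only [SimpleGraph.fromEdgeSet_adj, coe_filter, mem_univ, true_and, Set.mem_ofPred_eq,
      SimpleGraph.mem_edgeSet]
    exact ⟨fun h => h.1, fun h => ⟨h, h.ne⟩⟩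
  · intro t ht
    ext e
    have := @mem_powerset.1 ht e
    simp only [SimpleGraph.edgeSet_fromEdgeSet, mem_filter, mem_univ, true_and]
    simp only [mem_filter] at this
    simp only [Set.mem_sdiff, mem_coe]
    exact ⟨fun h => h.1, fun h => ⟨h, (this h).2⟩⟩
  · intro g _
    rfl

theorem fullWeight_empty [CommRing R] (w : Sym2 ι → R) : fullWeight w ∅ = 1 := by
  simp [fullWeight]

theorem fullWeight_insert [DecidableEq ι] [CommRing R] (w : Sym2 ι → R) {a : ι}
    {A : Finset ι} (ha : a ∉ A) :
    fullWeight w (insert a A) = (∏ j ∈ A, (1 + w s(a, j))) * fullWeight w A := by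
  classical
  have h : (insert a A).sym2.filter (fun e => ¬ e.IsDiag) =
      A.image (fun b => s(a, b)) ∪ A.sym2.filter (fun e => ¬ e.IsDiag) := by
    rw [sym2_insert]
    ext e
    simp only [mem_filter, mem_union, mem_image, mem_insert]
    constructor
    · rintro ⟨⟨b, rfl | hb, rfl⟩ | h, h'⟩
      · simp at h'
      · exact Or.inl ⟨b, hb, rfl⟩
      · exact Or.inr ⟨h, h'⟩
    · rintro (⟨b, hb, rfl⟩ | h)
      · refine ⟨Or.inl ⟨b, Or.inr hb, rfl⟩, ?_⟩
        rintro h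
        exact ha ((Sym2.mk_isDiag_iff.1 h) ▸ hb)
      · exact ⟨Or.inr h.1, h.2⟩
  have hd : Disjoint (A.image (fun b => s(a, b))) (A.sym2.filter (fun e => ¬ e.IsDiag)) := by
    rw [disjoint_left]
    intro e he he'
    obtain ⟨b, -, rfl⟩ := mem_image.1 he
    exact ha (mk_mem_sym2_iff.1 (mem_filter.1 he').1).1
  have key : ∀ A : Finset ι, fullWeight w A =
      ∏ e ∈ A.sym2.filter (fun e => ¬ e.IsDiag), (1 + w e) := fun A => by
    unfold fullWeight
    congr!
  rw [key, key, h, prod_union hd, prod_image]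
  exact fun i _ j _ hij => Sym2.congr_right.1 hij

theorem graphWeight_sup [Fintype ι] [CommRing R] (w : Sym2 ι → R) {g h : SimpleGraph ι}
    (hd : Disjoint g h) :
    graphWeight w (g ⊔ h) = graphWeight w g * graphWeight w h := by
  classical
  rw [graphWeight, graphWeight, graphWeight, ← prod_union]
  · congr 1
    ext e
    simp
  · rw [disjoint_filter]
    intro e _ h1 h2
    exact Set.disjoint_left.1 (SimpleGraph.disjoint_edgeSet.2 hd) h1 h2

/-- The part of a graph inside a set of vertices. -/
def SimpleGraph.inside (g : SimpleGraph ι) (A : Finset ι) : SimpleGraph ι where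
  Adj i j := g.Adj i j ∧ i ∈ A ∧ j ∈ A
  symm := ⟨fun _ _ h => ⟨h.1.symm, h.2.2, h.2.1⟩⟩
  loopless := ⟨fun _ h => h.1.ne rfl⟩

theorem SimpleGraph.Reachable.mem_of_closed {g : SimpleGraph ι} {A : Set ι}
    (hA : ∀ i j, g.Adj i j → i ∈ A → j ∈ A) {x y : ι} (h : g.Reachable x y) (hx : x ∈ A) :
    y ∈ A := by
  obtain ⟨p⟩ := h
  induction p with
  | nil => exact hx
  | cons hadj _ ih => exact ih (hA _ _ hadj hx)

theorem adj_mem_of_reach_eq [DecidableEq ι] {g : SimpleGraph ι} {X Y T : Finset ι}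
    (hs : g.SupportedIn (X ∪ Y)) (hT : ∀ y, y ∈ T ↔ y ∈ Y ∧ ∃ x ∈ X, g.Reachable x y)
    (i j : ι) (hij : g.Adj i j) (hi : i ∈ X ∪ T) : j ∈ X ∪ T := by
  rcases mem_union.1 (hs i j hij).2 with hj | hj
  · exact mem_union_left _ hj
  · refine mem_union_right _ ((hT j).2 ⟨hj, ?_⟩)
    rcases mem_union.1 hi with hi | hi
    · exact ⟨i, hi, hij.reachable⟩
    · obtain ⟨x, hx, hr⟩ := ((hT i).1 hi).2
      exact ⟨x, hx, hr.trans hij.reachable⟩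

theorem inside_sup_inside [DecidableEq ι] {g : SimpleGraph ι} {X Y T : Finset ι}
    (hs : g.SupportedIn (X ∪ Y)) (hT : ∀ y, y ∈ T ↔ y ∈ Y ∧ ∃ x ∈ X, g.Reachable x y) :
    g.inside (X ∪ T) ⊔ g.inside (Y \ T) = g := by
  ext i j
  constructor
  · rintro (h | h) <;> exact h.1
  · intro hij
    have h1 := adj_mem_of_reach_eq hs hT i j hij
    have h2 := adj_mem_of_reach_eq hs hT j i hij.symm
    have h3 := hs i j hij
    by_cases hi : i ∈ X ∪ T
    · exact Or.inl ⟨hij, hi, h1 hi⟩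
    · refine Or.inr ⟨hij, ?_, ?_⟩
      · grind
      · grind

open scoped Classical in
theorem fullWeight_union [Fintype ι] [DecidableEq ι] [CommRing R] (w : Sym2 ι → R)
    {X Y : Finset ι} (hXY : Disjoint X Y) :
    fullWeight w (X ∪ Y) = ∑ T ∈ Y.powerset, rootedSum w X T * fullWeight w (Y \ T) := by
  rw [fullWeight_eq_sum]
  rw [← sum_fiberwise_of_maps_to (t := Y.powerset)
    (g := fun g : SimpleGraph ι => Y.filter fun y => ∃ x ∈ X, g.Reachable x y)
    (fun g _ => mem_powerset.2 (filter_subset _ _))]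
  refine sum_congr rfl fun T hT => ?_
  rw [mem_powerset] at hT
  rw [fullWeight_eq_sum, rootedSum, sum_mul_sum, ← sum_product']
  have hdis : Disjoint (X ∪ T) (Y \ T) := by
    rw [disjoint_left]
    intro i hi hi'
    simp only [mem_union, mem_sdiff] at hi hi'
    rcases hi with hi | hi
    · exact disjoint_left.1 hXY hi hi'.1
    · exact hi'.2 hi
  have fiber : ∀ g : SimpleGraph ι, (Y.filter fun y => ∃ x ∈ X, g.Reachable x y) = T ↔
      ∀ y, y ∈ T ↔ y ∈ Y ∧ ∃ x ∈ X, g.Reachable x y := fun g => by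
    rw [eq_comm, Finset.ext_iff]
    simp only [mem_filter]
  refine sum_bij' (fun g _ => (g.inside (X ∪ T), g.inside (Y \ T))) (fun p _ => p.1 ⊔ p.2)
    ?_ ?_ ?_ ?_ ?_
  · intro g hg
    simp only [mem_filter, mem_univ, true_and, fiber] at hg
    obtain ⟨hs, hT'⟩ := hg
    have hcl := adj_mem_of_reach_eq hs hT'
    simp only [mem_product, mem_filter, mem_univ, true_and]
    refine ⟨⟨fun i j h => h.2, fun y hy => ?_⟩, fun i j h => h.2⟩
    obtain ⟨x, hx, hr⟩ := ((hT' y).1 hy).2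
    have hmem : y ∈ {z | z ∈ X ∪ T ∧ (g.inside (X ∪ T)).Reachable x z} := by
      refine hr.mem_of_closed (fun i j hij hi => ?_) ⟨mem_union_left _ hx, .refl _⟩
      have hj := (hcl i j hij) hi.1
      refine ⟨hj, hi.2.trans (SimpleGraph.Adj.reachable ?_)⟩
      exact ⟨hij, hi.1, hj⟩
    exact ⟨x, hx, hmem.2⟩
  · rintro ⟨g, h⟩ hp
    simp only [mem_product, mem_filter, mem_univ, true_and] at hp ⊢
    obtain ⟨⟨hg, hr⟩, hh⟩ := hp
    refine ⟨?_, ?_⟩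
    · rintro i j (hij | hij)
      · have := hg i j hij
        grind
      · have := hh i j hij
        grind
    · ext y
      simp only [mem_filter]
      constructor
      · rintro ⟨hy, x, hx, hxy⟩
        have : y ∈ ((X ∪ T : Finset ι) : Set ι) := by
          refine hxy.mem_of_closed ?_ (mem_union_left _ hx)
          rintro i j (hij | hij) hi
          · exact (hg i j hij).2
          · exact absurd (hh i j hij).1 (disjoint_left.1 hdis hi)
        rcases mem_union.1 this with h' | h'
        · exact absurd hy (disjoint_left.1 hXY h')
        · exact h'
      · intro hy
        obtain ⟨x, hx, hxy⟩ := hr y hy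
        exact ⟨hT hy, x, hx, hxy.mono le_sup_left⟩
  · intro g hg
    simp only [mem_filter, mem_univ, true_and, fiber] at hg
    obtain ⟨hs, hT'⟩ := hg
    exact inside_sup_inside hs hT'
  · rintro ⟨g, h⟩ hp
    simp only [mem_product, mem_filter, mem_univ, true_and] at hp
    obtain ⟨⟨hg, -⟩, hh⟩ := hp
    have hd : ∀ i ∈ X ∪ T, i ∉ Y \ T := fun i hi => disjoint_left.1 hdis hi
    refine Prod.ext ?_ ?_
    · ext i j
      constructor
      · rintro ⟨hij | hij, hi, -⟩
        · exact hij
        · exact absurd (hh i j hij).1 (hd i hi)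
      · exact fun hij => ⟨Or.inl hij, hg i j hij⟩
    · ext i j
      constructor
      · rintro ⟨hij | hij, hi, -⟩
        · exact absurd hi (hd i (hg i j hij).1)
        · exact hij
      · exact fun hij => ⟨Or.inr hij, hh i j hij⟩
  · intro g hg
    simp only [mem_filter, mem_univ, true_and, fiber] at hg
    rw [← graphWeight_sup, inside_sup_inside hg.1 hg.2]
    rw [disjoint_iff_inf_le]
    rintro i j ⟨h1, h2⟩
    exact (disjoint_left.1 hdis h1.2.1 h2.2.1).elim

theorem rootedSum_insert [Fintype ι] [DecidableEq ι] [CommRing R] (w : Sym2 ι → R) {a : ι}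
    {X : Finset ι} (ha : a ∉ X) (Y : Finset ι) (hY : Disjoint (insert a X) Y) :
    rootedSum w (insert a X) Y = (∏ j ∈ X, (1 + w s(a, j))) *
      ∑ S ∈ Y.powerset, (∏ y ∈ S, w s(a, y)) * rootedSum w (X ∪ S) (Y \ S) := by
  induction Y using Finset.strongInduction with
  | H Y ih =>
    have haY : a ∉ Y := disjoint_left.1 hY (mem_insert_self a X)
    have hXY : Disjoint X Y := hY.mono_left (subset_insert a X)
    have expand : fullWeight w (insert a X ∪ Y) = ∑ U ∈ Y.powerset,
        ((∏ j ∈ X, (1 + w s(a, j))) *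
          ∑ S ∈ U.powerset, (∏ y ∈ S, w s(a, y)) * rootedSum w (X ∪ S) (U \ S)) *
          fullWeight w (Y \ U) := by
      rw [insert_union, fullWeight_insert w (by simp [ha, haY]), prod_union hXY, mul_assoc,
        prod_one_add Y, sum_mul]
      simp_rw [mul_assoc]
      rw [← mul_sum]
      congr 1
      have step : ∀ S ∈ Y.powerset, (∏ y ∈ S, w s(a, y)) * fullWeight w (X ∪ Y) =
          ∑ T ∈ (Y \ S).powerset, (∏ y ∈ S, w s(a, y)) * rootedSum w (X ∪ S) T *
            fullWeight w (Y \ (S ∪ T)) := by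
        intro S hS
        rw [mem_powerset] at hS
        have : X ∪ Y = (X ∪ S) ∪ (Y \ S) := by
          rw [union_assoc, union_sdiff_of_subset hS]
        rw [this, fullWeight_union, mul_sum]
        · refine sum_congr rfl fun T _ => ?_
          rw [mul_assoc, sdiff_sdiff_left]
          rfl
        · rw [disjoint_left] at hXY ⊢
          grind
      rw [sum_congr rfl step]
      simp_rw [sum_mul]
      rw [sum_sigma', sum_sigma']
      refine sum_nbij' (fun p => ⟨p.1 ∪ p.2, p.1⟩) (fun p => ⟨p.2, p.1 \ p.2⟩) ?_ ?_ ?_ ?_ ?_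
      · rintro ⟨S, T⟩ h
        simp only [mem_sigma, mem_powerset] at h ⊢
        grind
      · rintro ⟨U, S⟩ h
        simp only [mem_sigma, mem_powerset] at h ⊢
        grind
      · rintro ⟨S, T⟩ h
        simp only [mem_sigma, mem_powerset] at h ⊢
        have : (S ∪ T) \ S = T := by grind
        rw [this]
      · rintro ⟨U, S⟩ h
        simp only [mem_sigma, mem_powerset] at h ⊢
        rw [union_sdiff_of_subset h.2]
      · rintro ⟨S, T⟩ h
        simp only [mem_sigma, mem_powerset] at h ⊢
        have : (S ∪ T) \ S = T := by grind
        rw [this]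
    rw [fullWeight_union w hY] at expand
    rw [← insert_erase (mem_powerset_self Y), sum_insert (notMem_erase _ _),
      sum_insert (notMem_erase _ _)] at expand
    have lower : ∀ U ∈ Y.powerset.erase Y, rootedSum w (insert a X) U * fullWeight w (Y \ U) =
        ((∏ j ∈ X, (1 + w s(a, j))) *
          ∑ S ∈ U.powerset, (∏ y ∈ S, w s(a, y)) * rootedSum w (X ∪ S) (U \ S)) *
          fullWeight w (Y \ U) := by
      intro U hU
      rw [mem_erase, mem_powerset] at hU
      rw [ih U (hU.2.ssubset_of_ne hU.1) (hY.mono_right hU.2)]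
    rw [sum_congr rfl lower] at expand
    simpa [fullWeight_empty] using add_right_cancel expand

theorem rootedSum_empty_left [Fintype ι] [DecidableEq ι] [CommRing R] (w : Sym2 ι → R)
    {Y : Finset ι} (hY : Y.Nonempty) : rootedSum w ∅ Y = 0 := by
  classical
  rw [rootedSum, filter_false_of_mem, sum_empty]
  rintro g - ⟨-, h⟩
  obtain ⟨y, hy⟩ := hY
  simpa using h y hy

theorem rootedSum_empty_right [Fintype ι] [DecidableEq ι] [CommRing R] (w : Sym2 ι → R)
    (X : Finset ι) : rootedSum w X ∅ = fullWeight w X := by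
  rw [rootedSum, fullWeight_eq_sum]
  refine sum_congr ?_ fun _ _ => rfl
  ext g
  simp only [mem_filter, union_empty]
  simp [SimpleGraph.Reaches]

open scoped Classical in
theorem sum_connected_eq_rootedSum [Fintype ι] [DecidableEq ι] [CommRing R] (w : Sym2 ι → R)
    (a : ι) : ∑ g ∈ univ.filter (fun g : SimpleGraph ι => g.Connected), graphWeight w g =
      rootedSum w {a} (univ.erase a) := by
  rw [rootedSum]
  congr 1
  refine filter_congr fun g _ => ?_
  constructor
  · intro h
    exact ⟨fun i j _ => by by_cases i = a <;> by_cases j = a <;> simp_all,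
      fun y _ => ⟨a, mem_singleton_self a, h.preconnected a y⟩⟩
  · rintro ⟨-, h⟩
    rw [SimpleGraph.connected_iff_exists_forall_reachable]
    refine ⟨a, fun y => ?_⟩
    by_cases hy : y = a
    · rw [hy]
    · simpa using h y (by simp [hy])

end GraphSums

section MayerBound

open Finset ENNReal

variable {ι : Type*}

/-- The Mayer weight `exp (-β V(|x_i - x_j|)) - 1` of an edge. -/
def mayerEdge (V : ℝ → ℝ) (β : ℝ) (x : ι → E3) (e : Sym2 ι) : ℝ :=
  Sym2.lift ⟨fun i j => Real.exp (-β * V ‖x i - x j‖) - 1,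
    fun i j => by simp only [norm_sub_rev (x i)]⟩ e

theorem mayerEdge_mk (V : ℝ → ℝ) (β : ℝ) (x : ι → E3) (i j : ι) :
    mayerEdge V β x s(i, j) = Real.exp (-β * V ‖x i - x j‖) - 1 := rfl

theorem measurable_mayerEdge {V : ℝ → ℝ} (hV : Measurable V) (β : ℝ) (e : Sym2 ι) :
    Measurable fun x : ι → E3 => mayerEdge V β x e := by
  induction e using Sym2.ind with
  | _ i j =>
    simp only [mayerEdge_mk]
    fun_prop

theorem measurable_rootedSum [Fintype ι] [DecidableEq ι] {V : ℝ → ℝ} (hV : Measurable V) (β : ℝ)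
    (X Y : Finset ι) : Measurable fun x : ι → E3 => rootedSum (mayerEdge V β x) X Y := by
  classical
  unfold rootedSum graphWeight
  exact Finset.measurable_sum _ fun g _ => Finset.measurable_prod _ fun e _ =>
    measurable_mayerEdge hV β e

/-- The total Mayer weight, as an extended nonnegative real. -/
def mayerMass (V : ℝ → ℝ) (β : ℝ) : ℝ≥0∞ := ∫⁻ z : E3, ‖Real.exp (-β * V ‖z‖) - 1‖ₑ

theorem two_mul_pairEnergy (V : ℝ → ℝ) {N : ℕ} (x : Fin N → E3) :
    2 * pairEnergy V x = ∑ i, ∑ j ∈ univ.erase i, V ‖x i - x j‖ := by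
  have h1 : ∑ i, ∑ j ∈ univ.erase i, V ‖x i - x j‖ =
      ∑ p ∈ univ.filter (fun p : Fin N × Fin N => p.1 ≠ p.2), V ‖x p.1 - x p.2‖ := by
    rw [sum_sigma']
    refine sum_nbij' (fun p => (p.1, p.2)) (fun p => ⟨p.1, p.2⟩) ?_ ?_ ?_ ?_ ?_
    all_goals simp [eq_comm]
  have h2 : univ.filter (fun p : Fin N × Fin N => p.1 ≠ p.2) =
      univ.filter (fun p : Fin N × Fin N => p.1 < p.2) ∪
        univ.filter (fun p : Fin N × Fin N => p.2 < p.1) := by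
    ext p
    simp [lt_or_lt_iff_ne]
  have h3 : ∑ p ∈ univ.filter (fun p : Fin N × Fin N => p.2 < p.1), V ‖x p.1 - x p.2‖ =
      pairEnergy V x := by
    refine sum_nbij' Prod.swap Prod.swap ?_ ?_ ?_ ?_ ?_
    all_goals simp [norm_sub_rev]
  rw [h1, h2, sum_union, h3, two_mul]
  · rfl
  · rw [disjoint_filter]
    exact fun p _ h => h.le.not_gt

theorem IsStableWith.exists_sum_ge [DecidableEq ι] {V : ℝ → ℝ} {B : ℝ} (hB : IsStableWith V B)
    {X : Finset ι} (hX : X.Nonempty) (x : ι → E3) :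
    ∃ a ∈ X, -(2 * B) ≤ ∑ j ∈ X.erase a, V ‖x a - x j‖ := by
  refine exists_le_of_sum_le (f := fun _ => -(2 * B)) hX ?_
  have e := X.equivFin.symm
  have h := hB.2 X.card (fun i => x (e i))
  have h2 := two_mul_pairEnergy V (fun i => x (e i))
  have h3 : ∑ a ∈ X, ∑ j ∈ X.erase a, V ‖x a - x j‖ =
      ∑ i, ∑ j ∈ univ.erase i, V ‖x (e i) - x (e j)‖ := by
    rw [← sum_coe_sort X, ← e.sum_comp]
    refine sum_congr rfl fun i _ => ?_
    symm
    refine sum_bij (fun j _ => (e j : ι)) ?_ ?_ ?_ ?_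
    · intro j hj
      simp only [mem_erase, mem_univ, and_true] at hj
      simp [hj]
    · intro j _ k _ hjk
      simpa [Subtype.val_inj] using hjk
    · intro j hj
      rw [mem_erase] at hj
      refine ⟨e.symm ⟨j, hj.2⟩, ?_, by simp⟩
      simp only [mem_erase, mem_univ, and_true]
      intro h
      simp [← h] at hj
    · intro j _
      rfl
  rw [h3, ← h2, sum_const, nsmul_eq_mul]
  linarith

theorem prod_one_add_mayerEdge (V : ℝ → ℝ) (β : ℝ) (x : ι → E3) (a : ι) (X : Finset ι) :
    ∏ j ∈ X, (1 + mayerEdge V β x s(a, j)) = Real.exp (-β * ∑ j ∈ X, V ‖x a - x j‖) := by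
  simp only [mayerEdge_mk, add_sub_cancel, mul_sum, Real.exp_sum]

theorem mayerEdge_congr (V : ℝ → ℝ) (β : ℝ) {x y : ι → E3} {i j : ι} (hi : x i = y i)
    (hj : x j = y j) : mayerEdge V β x s(i, j) = mayerEdge V β y s(i, j) := by
  rw [mayerEdge_mk, mayerEdge_mk, hi, hj]

theorem measurable_prod_mayerEdge {V : ℝ → ℝ} (hV : Measurable V) (β : ℝ) (a : ι)
    (S : Finset ι) : Measurable fun x : ι → E3 => ∏ y ∈ S, ‖mayerEdge V β x s(a, y)‖ₑ :=
  Finset.measurable_prod _ fun _ _ => (measurable_mayerEdge hV β _).enorm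

theorem lmarginal_const_mul [DecidableEq ι] {f : (ι → E3) → ℝ≥0∞} (hf : Measurable f)
    (S : Finset ι) (c : ℝ≥0∞) (x : ι → E3) :
    lmarginal (fun _ => volume) S (fun z => c * f z) x =
      c * lmarginal (fun _ => volume) S f x :=
  lintegral_const_mul c (hf.comp measurable_updateFinset)

theorem lmarginal_prod_mayerEdge [DecidableEq ι] {V : ℝ → ℝ} (hV : Measurable V) (β : ℝ)
    {a : ι} (S : Finset ι) (ha : a ∉ S) :
    (lmarginal (fun _ => volume) S fun x : ι → E3 => ∏ y ∈ S, ‖mayerEdge V β x s(a, y)‖ₑ) =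
      fun _ => mayerMass V β ^ S.card := by
  induction S using Finset.induction_on with
  | empty => simp
  | insert i S hi ih =>
    rw [mem_insert, not_or] at ha
    rw [lmarginal_insert' _ (measurable_prod_mayerEdge hV β a _) hi]
    have h : (fun x : ι → E3 => ∫⁻ z, ∏ y ∈ insert i S,
        ‖mayerEdge V β (Function.update x i z) s(a, y)‖ₑ) =
        fun x => mayerMass V β * ∏ y ∈ S, ‖mayerEdge V β x s(a, y)‖ₑ := by
      funext x
      have : ∀ z : E3, ∏ y ∈ insert i S, ‖mayerEdge V β (Function.update x i z) s(a, y)‖ₑ =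
          ‖Real.exp (-β * V ‖x a - z‖) - 1‖ₑ * ∏ y ∈ S, ‖mayerEdge V β x s(a, y)‖ₑ := by
        intro z
        rw [prod_insert hi]
        congr 1
        · rw [mayerEdge_mk, Function.update_self, Function.update_of_ne ha.1]
        · refine prod_congr rfl fun y hy => ?_
          rw [mayerEdge_congr V β (Function.update_of_ne ha.1 _ _)
            (Function.update_of_ne (ne_of_mem_of_not_mem hy hi) _ _)]
      simp_rw [this]
      rw [lintegral_mul_const _ (by fun_prop)]
      congr 1
      exact lintegral_sub_left_eq_self (fun z : E3 => ‖Real.exp (-β * V ‖z‖) - 1‖ₑ) (x a)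
    rw [h]
    funext x
    have ih' := congrFun (ih ha.2) x
    rw [lmarginal_const_mul (measurable_prod_mayerEdge hV β a S), ih',
      card_insert_of_notMem hi, pow_succ']

theorem lmarginal_rootedSum_insert_le [Fintype ι] [DecidableEq ι] {V : ℝ → ℝ} (hV : Measurable V)
    (β : ℝ) {a : ι} {X Y : Finset ι} (ha : a ∉ X) (hY : Disjoint (insert a X) Y)
    (x : ι → E3) {D : ℝ} (hD : Real.exp (-β * ∑ j ∈ X, V ‖x a - x j‖) ≤ D)
    {K : ℕ → ℝ≥0∞} (hK : ∀ S ⊆ Y, ∀ z : ι → E3, (lmarginal (fun _ => volume) (Y \ S)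
      fun x : ι → E3 => ‖rootedSum (mayerEdge V β x) (X ∪ S) (Y \ S)‖ₑ) z ≤ K S.card) :
    (lmarginal (fun _ => volume) Y
      fun x : ι → E3 => ‖rootedSum (mayerEdge V β x) (insert a X) Y‖ₑ) x ≤
      ENNReal.ofReal D * ∑ s ∈ range (Y.card + 1),
        Y.card.choose s * (mayerMass V β ^ s * K s) := by
  have haY : a ∉ Y := disjoint_left.1 hY (mem_insert_self a X)
  let G : Finset ι → (ι → E3) → ℝ≥0∞ := fun S x =>
    (∏ y ∈ S, ‖mayerEdge V β x s(a, y)‖ₑ) * ‖rootedSum (mayerEdge V β x) (X ∪ S) (Y \ S)‖ₑ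
  have hG : ∀ S, Measurable (G S) := fun S =>
    (measurable_prod_mayerEdge hV β a S).mul (measurable_rootedSum hV β _ _).enorm
  have hbdInt : ∀ S ∈ Y.powerset, (lmarginal (fun _ => volume) Y (G S)) x ≤
      mayerMass V β ^ S.card * K S.card := by
    intro S hS
    rw [mem_powerset] at hS
    have hle : lmarginal (fun _ => volume) (Y \ S) (G S) ≤
        fun z => (∏ y ∈ S, ‖mayerEdge V β z s(a, y)‖ₑ) * K S.card := by
      intro z
      have hpt : ∀ u, G S (Function.updateFinset z (Y \ S) u) =
          (∏ y ∈ S, ‖mayerEdge V β z s(a, y)‖ₑ) *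
            ‖rootedSum (mayerEdge V β (Function.updateFinset z (Y \ S) u)) (X ∪ S) (Y \ S)‖ₑ := by
        intro u
        simp only [G]
        congr 1
        refine prod_congr rfl fun y hy => ?_
        rw [mayerEdge_congr V β (y := z)]
        · simp [Function.updateFinset, haY]
        · simp [Function.updateFinset, hy]
      calc lmarginal (fun _ => volume) (Y \ S) (G S) z
          = lmarginal (fun _ => volume) (Y \ S) (fun v => (∏ y ∈ S, ‖mayerEdge V β z s(a, y)‖ₑ) *
            ‖rootedSum (mayerEdge V β v) (X ∪ S) (Y \ S)‖ₑ) z := lintegral_congr hpt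
        _ ≤ _ := by
          rw [lmarginal_const_mul (measurable_rootedSum hV β _ _).enorm]
          exact mul_le_mul' le_rfl (hK S hS z)
    have hY' : Y = S ∪ (Y \ S) := (union_sdiff_of_subset hS).symm
    calc (lmarginal (fun _ => volume) Y (G S)) x
        = (lmarginal (fun _ => volume) S (lmarginal (fun _ => volume) (Y \ S) (G S))) x := by
          conv_lhs => rw [hY']
          rw [lmarginal_union _ _ (hG S) disjoint_sdiff]
      _ ≤ (lmarginal (fun _ => volume) S
            fun z => (∏ y ∈ S, ‖mayerEdge V β z s(a, y)‖ₑ) * K S.card) x := lmarginal_mono hle x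
      _ = mayerMass V β ^ S.card * K S.card := by
          have := congrFun (lmarginal_prod_mayerEdge hV β S fun h => haY (hS h)) x
          simp_rw [mul_comm _ (K S.card)]
          rw [lmarginal_const_mul (measurable_prod_mayerEdge hV β a S), this]
  calc (lmarginal (fun _ => volume) Y
        fun x : ι → E3 => ‖rootedSum (mayerEdge V β x) (insert a X) Y‖ₑ) x
      ≤ ∫⁻ u : Y → E3, ENNReal.ofReal D *
          ∑ S ∈ Y.powerset, G S (Function.updateFinset x Y u) ∂Measure.pi fun _ => volume := by
        refine lintegral_mono fun u => ?_
        beta_reduce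
        rw [rootedSum_insert _ ha Y hY, enorm_mul, prod_one_add_mayerEdge]
        gcongr
        · rw [Real.enorm_eq_ofReal (Real.exp_nonneg _)]
          refine ENNReal.ofReal_le_ofReal (le_trans (le_of_eq ?_) hD)
          congr 2
          refine sum_congr rfl fun j hj => ?_
          have : j ∉ Y := disjoint_left.1 hY (mem_insert_of_mem hj)
          simp [Function.updateFinset, haY, this]
        · refine (enorm_sum_le _ _).trans (sum_le_sum fun S _ => ?_)
          rw [enorm_mul]
          simp only [G]
          gcongr
          simp only [Real.enorm_eq_ofReal_abs, abs_prod]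
          rw [ENNReal.ofReal_prod_of_nonneg fun _ _ => abs_nonneg _]
    _ = ENNReal.ofReal D * ∑ S ∈ Y.powerset, (lmarginal (fun _ => volume) Y (G S)) x := by
        have hG' : ∀ S ∈ Y.powerset, Measurable fun u : Y → E3 =>
            G S (Function.updateFinset x Y u) := fun S _ => (hG S).comp measurable_updateFinset
        rw [lintegral_const_mul _ (Finset.measurable_fun_sum _ hG'), lintegral_finsetSum _ hG']
        rfl
    _ ≤ ENNReal.ofReal D * ∑ S ∈ Y.powerset, mayerMass V β ^ S.card * K S.card := by
        gcongr with S hS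
        exact hbdInt S hS
    _ = _ := by
        rw [sum_powerset_apply_card (fun s => mayerMass V β ^ s * K s)]
        simp only [nsmul_eq_mul]

/-- The number of forests on `m + n` labelled vertices with `m` prescribed roots. -/
def forestCount (m : ℕ) : ℕ → ℕ
  | 0 => 1
  | n + 1 => m * (m + (n + 1)) ^ n

theorem add_mul_forestCount (m n : ℕ) : (m + n) * forestCount m n = m * (m + n) ^ n := by
  cases n with
  | zero => simp [forestCount]
  | succ n => rw [forestCount, pow_succ]; ring

theorem forestCount_succ (m n : ℕ) :
    ∑ s ∈ range (n + 1), n.choose s * forestCount (m + s) (n - s) = forestCount (m + 1) n := by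
  rcases Nat.eq_zero_or_pos (m + n) with h | h
  · obtain ⟨rfl, rfl⟩ : m = 0 ∧ n = 0 := by omega
    simp [forestCount]
  refine Nat.eq_of_mul_eq_mul_left h ?_
  have binom : ∀ b k : ℕ, ∑ i ∈ range (k + 1), b ^ (k - i) * k.choose i = (1 + b) ^ k :=
    fun b k => by simpa using (add_pow 1 b k).symm
  rw [mul_sum]
  have h1 : ∀ s ∈ range (n + 1), (m + n) * (n.choose s * forestCount (m + s) (n - s)) =
      m * ((m + n) ^ (n - s) * n.choose s) + s * n.choose s * (m + n) ^ (n - s) := by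
    intro s hs
    have hs' : s ≤ n := by simpa [Nat.lt_succ_iff] using hs
    have := add_mul_forestCount (m + s) (n - s)
    rw [show m + s + (n - s) = m + n by omega] at this
    rw [mul_left_comm, this]
    ring
  rw [sum_congr rfl h1, sum_add_distrib, ← mul_sum, binom]
  cases n with
  | zero => simp [forestCount]
  | succ n =>
    rw [sum_range_succ']
    have h2 : ∀ s ∈ range (n + 1),
        (s + 1) * (n + 1).choose (s + 1) * (m + (n + 1)) ^ (n + 1 - (s + 1)) =
        (n + 1) * ((m + (n + 1)) ^ (n - s) * n.choose s) := by
      intro s _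
      rw [mul_comm (s + 1), ← Nat.add_one_mul_choose_eq, Nat.add_sub_add_right]
      ring
    rw [sum_congr rfl h2, ← mul_sum, binom, forestCount]
    ring

theorem lmarginal_rootedSum_le [Fintype ι] [DecidableEq ι] {V : ℝ → ℝ} (hV : Measurable V)
    {B : ℝ} (hB : IsStableWith V B) {β : ℝ} (hβ : 0 < β) {X Y : Finset ι} (hXY : Disjoint X Y)
    (x : ι → E3) :
    (lmarginal (fun _ => volume) Y fun x : ι → E3 => ‖rootedSum (mayerEdge V β x) X Y‖ₑ) x ≤
      ENNReal.ofReal (Real.exp (2 * β * B)) ^ (X.card + Y.card) * mayerMass V β ^ Y.card *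
        forestCount X.card Y.card := by
  induction hk : X.card + Y.card generalizing X Y x with
  | zero =>
    obtain ⟨h1, h2⟩ : X.card = 0 ∧ Y.card = 0 := by omega
    rw [card_eq_zero] at h1 h2
    subst h1 h2
    simp [rootedSum_empty_right, fullWeight_empty, forestCount]
  | succ k ih =>
    rcases X.eq_empty_or_nonempty with rfl | hX
    · have hY : Y.Nonempty := by
        rw [← card_pos]
        simp at hk
        omega
      simp [rootedSum_empty_left _ hY, lmarginal]
    obtain ⟨a, ha, hge⟩ := hB.exists_sum_ge hX x
    set X' := X.erase a with hX'
    have haX' : a ∉ X' := notMem_erase a X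
    have hXins : X = insert a X' := (insert_erase ha).symm
    have hcard : X.card = X'.card + 1 := by rw [hXins, card_insert_of_notMem haX']
    have hD : Real.exp (-β * ∑ j ∈ X', V ‖x a - x j‖) ≤ Real.exp (2 * β * B) := by
      rw [Real.exp_le_exp]
      nlinarith
    set D := ENNReal.ofReal (Real.exp (2 * β * B)) with hDdef
    have hstep := lmarginal_rootedSum_insert_le hV β haX' (hXins ▸ hXY) x hD
      (K := fun s => D ^ k * mayerMass V β ^ (Y.card - s) *
        forestCount (X'.card + s) (Y.card - s)) (by
        intro S hS z
        have hdisj : Disjoint X' S := (hXY.mono_left (erase_subset a X)).mono_right hS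
        have hc1 : (X' ∪ S).card = X'.card + S.card := card_union_of_disjoint hdisj
        have hc2 : (Y \ S).card = Y.card - S.card := card_sdiff_of_subset hS
        have hle := card_le_card hS
        have := ih (X := X' ∪ S) (Y := Y \ S) (by
          rw [disjoint_left] at hXY ⊢
          grind) z (by omega)
        rwa [hc1, hc2] at this)
    rw [← hXins] at hstep
    refine hstep.trans (le_of_eq ?_)
    rw [hcard, ← forestCount_succ, Nat.cast_sum, mul_sum, mul_sum]
    refine sum_congr rfl fun s hs => ?_
    have hs' : s ≤ Y.card := by simpa [Nat.lt_succ_iff] using hs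
    have hpow : mayerMass V β ^ Y.card = mayerMass V β ^ s * mayerMass V β ^ (Y.card - s) := by
      rw [← pow_add, Nat.add_sub_of_le hs']
    rw [hpow, ← hDdef, pow_succ]
    push_cast
    ring

theorem lmarginal_rootedSum_singleton_le [Fintype ι] [DecidableEq ι] {V : ℝ → ℝ} (hV : Measurable V)
    {B : ℝ} (hB : IsStableWith V B) {β : ℝ} (hβ : 0 < β) (a : ι) (x : ι → E3) :
    (lmarginal (fun _ => volume) (univ.erase a)
      fun x : ι → E3 => ‖rootedSum (mayerEdge V β x) {a} (univ.erase a)‖ₑ) x ≤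
      ENNReal.ofReal (Real.exp (2 * β * B)) ^ (univ.erase a).card *
        mayerMass V β ^ (univ.erase a).card * forestCount 1 (univ.erase a).card := by
  set Y : Finset ι := univ.erase a with hY
  set D := ENNReal.ofReal (Real.exp (2 * β * B)) with hDdef
  have hstep := lmarginal_rootedSum_insert_le hV β (a := a) (X := ∅) (Y := Y) (notMem_empty a)
    (by simp [hY]) x (D := 1) (by simp)
    (K := fun s => D ^ Y.card * mayerMass V β ^ (Y.card - s) * forestCount s (Y.card - s)) (by
      intro S hS z
      have hc : (Y \ S).card = Y.card - S.card := card_sdiff_of_subset hS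
      have := lmarginal_rootedSum_le hV hB hβ (X := S) (Y := Y \ S) disjoint_sdiff z
      rw [hc, Nat.add_sub_of_le (card_le_card hS)] at this
      rwa [empty_union])
  refine hstep.trans (le_of_eq ?_)
  rw [show forestCount 1 Y.card = _ from (forestCount_succ 0 Y.card).symm, Nat.cast_sum,
    mul_sum, mul_sum]
  refine sum_congr rfl fun s hs => ?_
  have hs' : s ≤ Y.card := by
    simp only [mem_range] at hs
    omega
  have hpow : mayerMass V β ^ Y.card = mayerMass V β ^ s * mayerMass V β ^ (Y.card - s) := by
    rw [← pow_add, Nat.add_sub_of_le hs']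
  rw [hpow, ENNReal.ofReal_one, zero_add]
  push_cast
  ring

theorem IsStableWith.neg_two_mul_le {V : ℝ → ℝ} {B : ℝ} (hB : IsStableWith V B) (z : E3) :
    -(2 * B) ≤ V ‖z‖ := by
  obtain ⟨i, -, h⟩ := hB.exists_sum_ge (X := (univ : Finset (Fin 2))) univ_nonempty ![z, 0]
  fin_cases i
  · have : (univ : Finset (Fin 2)).erase 0 = {1} := rfl
    simpa [this] using h
  · have : (univ : Finset (Fin 2)).erase 1 = {0} := rfl
    simpa [this] using h

theorem abs_exp_sub_one_le_mul_exp {t M : ℝ} (hM : 0 ≤ M) (ht : t ≤ M) :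
    |Real.exp t - 1| ≤ Real.exp M * |t| := by
  have hexpM : 1 ≤ Real.exp M := Real.one_le_exp hM
  rcases le_total t 0 with h | h
  · have h1 : Real.exp t ≤ 1 := Real.exp_le_one_iff.2 h
    have h2 := Real.add_one_le_exp t
    rw [abs_of_nonpos (by linarith), abs_of_nonpos h]
    nlinarith
  · have h1 : 1 ≤ Real.exp t := Real.one_le_exp h
    have h2 := Real.add_one_le_exp (-t)
    have h3 : Real.exp t * Real.exp (-t) = 1 := by rw [← Real.exp_add]; simp
    have h4 : Real.exp t ≤ Real.exp M := Real.exp_le_exp.2 ht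
    rw [abs_of_nonneg (by linarith), abs_of_nonneg h]
    nlinarith [Real.exp_pos t]

theorem integrable_mayer {V : ℝ → ℝ} (hV : Measurable V) {B : ℝ} (hB : IsStableWith V B)
    (hT : IsTempered V) {β : ℝ} (hβ : 0 < β) :
    Integrable fun z : E3 => Real.exp (-β * V ‖z‖) - 1 := by
  obtain ⟨r, -, hr⟩ := hT
  have hmeas : Measurable fun z : E3 => Real.exp (-β * V ‖z‖) - 1 := by fun_prop
  have hle : ∀ z : E3, -β * V ‖z‖ ≤ 2 * β * B := fun z => by
    nlinarith [hB.neg_two_mul_le z]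
  have hM : 0 ≤ 2 * β * B := by
    have := hB.1
    positivity
  have hout : IntegrableOn (fun z : E3 => Real.exp (-β * V ‖z‖) - 1) {z | r ≤ ‖z‖} := by
    refine Integrable.mono' (hr.const_mul (Real.exp (2 * β * B) * β))
      hmeas.aestronglyMeasurable (Filter.Eventually.of_forall fun z => ?_)
    have := abs_exp_sub_one_le_mul_exp hM (hle z)
    rwa [abs_mul, abs_neg, abs_of_pos hβ, ← mul_assoc] at this
  have hin : IntegrableOn (fun z : E3 => Real.exp (-β * V ‖z‖) - 1) (Metric.ball 0 r) := by
    refine Measure.integrableOn_of_bounded (M := Real.exp (2 * β * B) + 1)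
      measure_ball_lt_top.ne hmeas.aestronglyMeasurable (Filter.Eventually.of_forall fun z => ?_)
    have h1 := Real.exp_le_exp.2 (hle z)
    have h2 := Real.exp_pos (-β * V ‖z‖)
    rw [Real.norm_eq_abs, abs_le]
    constructor <;> linarith
  rw [← integrableOn_univ]
  refine (hout.union hin).mono_set fun z _ => ?_
  rcases le_or_gt r ‖z‖ with h | h
  · exact Or.inl h
  · exact Or.inr (by simpa using h)

end MayerBound

/-- Penrose-Ruelle: bound on the `n`-th Mayer coefficient for a
stable and tempered pair potential. -/
theorem stmt5 (V : ℝ → ℝ) (hV : Measurable V) (B : ℝ) (hB : IsStableWith V B)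
    (hT : IsTempered V) (β : ℝ) (hβ : 0 < β) (Λ : Set E3)
    (hbd : Bornology.IsBounded Λ) (hm : MeasurableSet Λ) (hΛ : 0 < volume Λ)
    (n : ℕ) (hn : 2 ≤ n) :
    |mayerCoeff V β Λ n| ≤
      Real.exp (2 * β * B * ((n : ℝ) - 1)) * (n : ℝ) ^ (n - 2) *
        (∫ x : E3, |Real.exp (-β * V ‖x‖) - 1|) ^ (n - 1) / n.factorial := by
  obtain ⟨k, rfl⟩ : ∃ k, n = k + 2 := ⟨n - 2, by omega⟩
  set C := ∫ x : E3, |Real.exp (-β * V ‖x‖) - 1| with hC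
  have hC0 : 0 ≤ C := integral_nonneg fun _ => abs_nonneg _
  have hfin : volume Λ ≠ ⊤ := hbd.measure_lt_top.ne
  have hpos : 0 < (volume Λ).toReal := ENNReal.toReal_pos hΛ.ne' hfin
  have hmass : mayerMass V β = ENNReal.ofReal C :=
    (ofReal_integral_norm_eq_lintegral_enorm (integrable_mayer hV hB hT hβ)).symm
  let Y : Finset (Fin (k + 2)) := Finset.univ.erase 0
  have hYcard : Y.card = k + 1 := by simp [Y]
  let Φ : (Fin (k + 2) → E3) → ℝ := fun x => rootedSum (mayerEdge V β x) {0} Y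
  let K : ℝ := Real.exp (2 * β * B) ^ (k + 1) * C ^ (k + 1) * ((k + 2 : ℕ) : ℝ) ^ k
  have hK0 : 0 ≤ K := by positivity
  have hcoeff : mayerCoeff V β Λ (k + 2) = (volume Λ).toReal⁻¹ * ((k + 2).factorial : ℝ)⁻¹ *
      ∫ x in Set.univ.pi fun _ => Λ, Φ x := by
    rw [mayerCoeff]
    congr 2
    funext x
    exact sum_connected_eq_rootedSum (mayerEdge V β x) 0
  have hmarg : ∀ x, lmarginal (fun _ => volume) Y (fun x => ‖Φ x‖ₑ) x ≤ ENNReal.ofReal K := by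
    intro x
    refine (lmarginal_rootedSum_singleton_le hV hB hβ (0 : Fin (k + 2)) x).trans (le_of_eq ?_)
    change _ ^ Y.card * _ ^ Y.card * (forestCount 1 Y.card : ENNReal) = _
    rw [hYcard, hmass, ENNReal.ofReal_mul (by positivity), ENNReal.ofReal_mul (by positivity),
      ENNReal.ofReal_pow (Real.exp_nonneg _), ENNReal.ofReal_pow hC0, ← Nat.cast_pow,
      ENNReal.ofReal_natCast, forestCount]
    congr 2
    ring
  have hΦ : Measurable Φ := measurable_rootedSum hV β _ _
  have hbound : ∫⁻ x in Set.univ.pi fun _ => Λ, ‖Φ x‖ₑ ≤ ENNReal.ofReal K * volume Λ := by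
    let F : (Fin (k + 2) → E3) → ENNReal := fun x => Λ.indicator 1 (x 0) * ‖Φ x‖ₑ
    have hind : Measurable (Λ.indicator (1 : E3 → ENNReal)) := measurable_one.indicator hm
    have hF : Measurable F := (hind.comp (measurable_pi_apply 0)).mul hΦ.enorm
    calc ∫⁻ x in Set.univ.pi fun _ => Λ, ‖Φ x‖ₑ
        = ∫⁻ x, (Set.univ.pi fun _ => Λ).indicator (fun x => ‖Φ x‖ₑ) x :=
          (lintegral_indicator (MeasurableSet.univ_pi fun _ => hm) _).symm
      _ ≤ ∫⁻ x, F x := by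
          refine lintegral_mono fun x => ?_
          by_cases hx : x ∈ Set.univ.pi fun _ => Λ
          · simp [F, Set.indicator_of_mem hx, Set.indicator_of_mem (hx 0 trivial)]
          · simp [Set.indicator_of_notMem hx]
      _ = ∫⁻ z, lmarginal (fun _ => volume) Y F (Function.update (0 : Fin (k + 2) → E3) 0 z) := by
          have := lintegral_eq_lmarginal_univ (μ := fun _ : Fin (k + 2) => (volume : Measure E3))
            (f := F) 0
          rw [volume_pi, this, lmarginal_erase F hF (Finset.mem_univ 0)]
      _ ≤ ∫⁻ z, Λ.indicator 1 z * ENNReal.ofReal K := by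
          refine lintegral_mono fun z => ?_
          have h0 : ∀ u : Y → E3,
              Function.updateFinset (Function.update (0 : Fin (k + 2) → E3) 0 z) Y u 0 = z := by
            intro u
            simp [Function.updateFinset, Y]
          calc lmarginal (fun _ => volume) Y F (Function.update (0 : Fin (k + 2) → E3) 0 z)
              = lmarginal (fun _ => volume) Y (fun x => Λ.indicator 1 z * ‖Φ x‖ₑ)
                  (Function.update (0 : Fin (k + 2) → E3) 0 z) :=
                lintegral_congr fun u => by simp only [F, h0]
            _ ≤ _ := by
                rw [lmarginal_const_mul hΦ.enorm]
                exact mul_le_mul' le_rfl (hmarg _)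
      _ = ENNReal.ofReal K * volume Λ := by
          rw [lintegral_mul_const _ hind, lintegral_indicator_one hm, mul_comm]
  have hbdInt : |∫ x in Set.univ.pi fun _ => Λ, Φ x| ≤ K * (volume Λ).toReal := by
    have h1 := (enorm_integral_le_lintegral_enorm (μ := volume.restrict
      (Set.univ.pi fun _ : Fin (k + 2) => Λ)) Φ).trans hbound
    have h2 := ENNReal.toReal_mono (ENNReal.mul_ne_top ENNReal.ofReal_ne_top hfin) h1
    rwa [toReal_enorm, Real.norm_eq_abs, ENNReal.toReal_mul, ENNReal.toReal_ofReal hK0] at h2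
  rw [hcoeff, abs_mul, abs_of_nonneg (by positivity)]
  calc (volume Λ).toReal⁻¹ * ((k + 2).factorial : ℝ)⁻¹ * |∫ x in Set.univ.pi fun _ => Λ, Φ x|
      ≤ (volume Λ).toReal⁻¹ * ((k + 2).factorial : ℝ)⁻¹ * (K * (volume Λ).toReal) := by gcongr
    _ = K / (k + 2).factorial := by field_simp
    _ = _ := by
        have he : Real.exp (2 * β * B * (((k + 2 : ℕ) : ℝ) - 1)) =
            Real.exp (2 * β * B) ^ (k + 1) := by
          rw [← Real.exp_nat_mul]
          congr 1
          push_cast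
          ring
        rw [he, Nat.add_sub_cancel, show k + 2 - 1 = k + 1 by omega]
        simp only [K]
        ring

end
end

section
/- (Morais–Procacci–Scoppola) Let V = Φ₁ + Φ₂ be a measurable pair potential on (0,∞) such that Φ₁ is non-negative and tempered and Φ₂ is absolutely integrable over ℝ³ (i.e. ∫_{ℝ³}|Φ₂(|x|)|dx < ∞) and stable with constant B̃ ≥ 0. Then for every β > 0, every bounded measurable Λ ⊂ ℝ³ of positive volume, and every n ≥ 2, the n-th Mayer coefficient satisfies |C_n(β,Λ)| ≤ e^{βB̃n} · n^{n−2} · C̃(β)^{n−1} / n!, where C̃(β) = ∫_{ℝ³} [ |e^{−βΦ₁(|x|)} − 1| + β|Φ₂(|x|)| ] dx. -/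
open MeasureTheory Real

noncomputable section

section SubsetSums

variable {α : Type*} [DecidableEq α] {R : Type*} [AddCommMonoid R]

/-- Both iterated sums run over the ordered partitions of `S` into three parts. -/
lemma sum_powerset_powerset_assoc (S : Finset α) (F : Finset α → Finset α → Finset α → R) :
    ∑ A ∈ S.powerset, ∑ P ∈ A.powerset, F P (A \ P) (S \ A) =
      ∑ P ∈ S.powerset, ∑ Q ∈ (S \ P).powerset, F P Q ((S \ P) \ Q) := by
  rw [Finset.sum_sigma', Finset.sum_sigma']
  refine Finset.sum_nbij' (fun z => ⟨z.2, z.1 \ z.2⟩) (fun z => ⟨z.1 ∪ z.2, z.1⟩) ?_ ?_ ?_ ?_ ?_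
  · rintro ⟨A, P⟩ h
    simp only [Finset.mem_sigma, Finset.mem_powerset] at h ⊢
    exact ⟨h.2.trans h.1, Finset.sdiff_subset_sdiff h.1 le_rfl⟩
  · rintro ⟨P, Q⟩ h
    simp only [Finset.mem_sigma, Finset.mem_powerset] at h ⊢
    exact ⟨Finset.union_subset h.1 (h.2.trans Finset.sdiff_subset), Finset.subset_union_left⟩
  · rintro ⟨A, P⟩ h
    simp only [Finset.mem_sigma, Finset.mem_powerset] at h
    simp [Finset.union_sdiff_of_subset h.2]
  · rintro ⟨P, Q⟩ h
    simp only [Finset.mem_sigma, Finset.mem_powerset] at h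
    have hd : Disjoint Q P := (Finset.subset_sdiff.1 h.2).2
    simp [Finset.union_sdiff_left, hd.sdiff_eq_left]
  · rintro ⟨A, P⟩ h
    simp only [Finset.mem_sigma, Finset.mem_powerset] at h
    congr 1
    ext x
    have := @h.2 x
    simp only [Finset.mem_sdiff]
    tauto

lemma sum_powerset_sdiff_swap (S : Finset α) (F : Finset α → Finset α → R) :
    ∑ A ∈ S.powerset, F A (S \ A) = ∑ A ∈ S.powerset, F (S \ A) A := by
  refine Finset.sum_nbij' (fun A => S \ A) (fun A => S \ A) ?_ ?_ ?_ ?_ ?_ <;>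
    intro A hA <;> simp_all

end SubsetSums

section TreeSum

variable {α : Type*}

/-- Total weight of the edges between `A` and `B`. -/
def crossWeight (w : Sym2 α → NNReal) (A B : Finset α) : NNReal :=
  ∑ i ∈ A, ∑ j ∈ B, w s(i, j)

lemma crossWeight_comm (w : Sym2 α → NNReal) (A B : Finset α) :
    crossWeight w A B = crossWeight w B A := by
  unfold crossWeight
  rw [Finset.sum_comm]
  simp only [Sym2.eq_swap]

lemma crossWeight_congr {w w' : Sym2 α → NNReal} {A B : Finset α}
    (h : ∀ i ∈ A, ∀ j ∈ B, w s(i, j) = w' s(i, j)) : crossWeight w A B = crossWeight w' A B :=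
  Finset.sum_congr rfl fun i hi => Finset.sum_congr rfl fun j hj => h i hi j hj

variable [DecidableEq α]

lemma crossWeight_union_left (w : Sym2 α → NNReal) {A B : Finset α} (h : Disjoint A B)
    (D : Finset α) : crossWeight w (A ∪ B) D = crossWeight w A D + crossWeight w B D :=
  Finset.sum_union h

/-- The sum over all trees on the vertex set `S` of the product of the weights of the edges,
computed by removing an edge. -/
def treeSum (w : Sym2 α → NNReal) (S : Finset α) : NNReal :=
  if S.card = 1 then 1 else
    (2 * ((S.card - 1 : ℕ) : NNReal))⁻¹ * ∑ A ∈ S.powerset.attach,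
      if _h : A.1.Nonempty ∧ A.1 ≠ S then
        crossWeight w A.1 (S \ A.1) * (treeSum w A.1 * treeSum w (S \ A.1)) else 0
termination_by S.card
decreasing_by
  · exact Finset.card_lt_card ((Finset.mem_powerset.1 A.2).ssubset_of_ne _h.2)
  · exact Finset.card_lt_card (Finset.sdiff_ssubset (Finset.mem_powerset.1 A.2) _h.1)

lemma treeSum_of_card_eq_one (w : Sym2 α → NNReal) {S : Finset α} (h : S.card = 1) :
    treeSum w S = 1 := by
  rw [treeSum, if_pos h]

lemma treeSum_of_card_ne_one (w : Sym2 α → NNReal) {S : Finset α} (h : S.card ≠ 1) :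
    treeSum w S = (2 * ((S.card - 1 : ℕ) : NNReal))⁻¹ *
      ∑ A ∈ S.powerset, crossWeight w A (S \ A) * (treeSum w A * treeSum w (S \ A)) := by
  rw [treeSum, if_neg h,
    ← Finset.sum_attach S.powerset
      (fun A => crossWeight w A (S \ A) * (treeSum w A * treeSum w (S \ A)))]
  congr 1
  refine Finset.sum_congr rfl fun A _ => ?_
  split_ifs with hA
  · rfl
  · rw [not_and_or, Finset.not_nonempty_iff_eq_empty, not_not] at hA
    rcases hA with hA | hA <;> simp [hA, crossWeight]

lemma two_mul_card_sub_one_mul_treeSum (w : Sym2 α → NNReal) (S : Finset α) :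
    2 * ((S.card - 1 : ℕ) : NNReal) * treeSum w S =
      ∑ A ∈ S.powerset, crossWeight w A (S \ A) * (treeSum w A * treeSum w (S \ A)) := by
  rcases Nat.lt_trichotomy S.card 1 with h | h | h
  · have : S = ∅ := by simpa using h
    subst this; simp [crossWeight]
  · obtain ⟨i, rfl⟩ := Finset.card_eq_one.1 h
    rw [Finset.card_singleton]
    rw [Finset.sum_eq_zero, Nat.sub_self, Nat.cast_zero, mul_zero, zero_mul]
    intro A hA
    rcases Finset.subset_singleton_iff.1 (Finset.mem_powerset.1 hA) with rfl | rfl <;>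
      simp [crossWeight]
  · rw [treeSum_of_card_ne_one w h.ne', mul_inv_cancel_left₀]
    have : ((S.card - 1 : ℕ) : NNReal) ≠ 0 := by
      rw [Nat.cast_ne_zero]; omega
    positivity

lemma card_sub_one_mul_treeSum (w : Sym2 α → NNReal) {S : Finset α} {a : α} (ha : a ∈ S) :
    ((S.card - 1 : ℕ) : NNReal) * treeSum w S = ∑ A ∈ S.powerset,
      if a ∈ A then crossWeight w A (S \ A) * (treeSum w A * treeSum w (S \ A)) else 0 := by
  have h := two_mul_card_sub_one_mul_treeSum w S
  have hsplit : ∑ A ∈ S.powerset, crossWeight w A (S \ A) * (treeSum w A * treeSum w (S \ A)) =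
      (∑ A ∈ S.powerset,
        if a ∈ A then crossWeight w A (S \ A) * (treeSum w A * treeSum w (S \ A)) else 0) +
      ∑ A ∈ S.powerset,
        if a ∈ S \ A then crossWeight w A (S \ A) * (treeSum w A * treeSum w (S \ A)) else 0 := by
    rw [← Finset.sum_add_distrib]
    refine Finset.sum_congr rfl fun A _ => ?_
    by_cases hA : a ∈ A <;> simp [hA, ha]
  rw [sum_powerset_sdiff_swap S (fun A B =>
    if a ∈ B then crossWeight w A B * (treeSum w A * treeSum w B) else 0)] at hsplit
  simp only [crossWeight_comm w (S \ _) _, mul_comm (treeSum w (S \ _)) _] at hsplit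
  rw [hsplit, ← two_mul, mul_assoc] at h
  exact mul_left_cancel₀ two_ne_zero h

/-- Sum of `F A * F (S \ A)` over the ways to split `S` into two parts separating `a` from `b`. -/
def splitSum {R : Type*} [Semiring R] (F : Finset α → R) (a b : α) (S : Finset α) : R :=
  ∑ A ∈ S.powerset, if a ∈ A ∧ b ∈ S \ A then F A * F (S \ A) else 0

lemma splitSum_eq_zero {R : Type*} [Semiring R] (F : Finset α → R) {a b : α} {S : Finset α}
    (h : ¬(a ∈ S ∧ b ∈ S)) : splitSum F a b S = 0 := by
  refine Finset.sum_eq_zero fun A hA => if_neg fun h' => h ⟨?_, ?_⟩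
  · exact Finset.mem_powerset.1 hA h'.1
  · exact (Finset.mem_sdiff.1 h'.2).1

lemma sum_crossWeight_mul_splitSum (w : Sym2 α → NNReal) (S : Finset α) (a b : α) :
    ∑ A ∈ S.powerset, crossWeight w A (S \ A) * (splitSum (treeSum w) a b A * treeSum w (S \ A)) =
      ((S.card - 2 : ℕ) : NNReal) * splitSum (treeSum w) a b S := by
  have h1 : ∑ A ∈ S.powerset,
      crossWeight w A (S \ A) * (splitSum (treeSum w) a b A * treeSum w (S \ A)) =
      (∑ A ∈ S.powerset, ∑ P ∈ A.powerset, if a ∈ P ∧ b ∈ A \ P then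
        crossWeight w P (S \ A) * (treeSum w P * treeSum w (S \ A)) * treeSum w (A \ P) else 0) +
      ∑ A ∈ S.powerset, ∑ P ∈ A.powerset, if a ∈ P ∧ b ∈ A \ P then treeSum w P *
        (crossWeight w (A \ P) (S \ A) * (treeSum w (A \ P) * treeSum w (S \ A))) else 0 := by
    rw [← Finset.sum_add_distrib]
    refine Finset.sum_congr rfl fun A _ => ?_
    rw [splitSum, Finset.sum_mul, Finset.mul_sum, ← Finset.sum_add_distrib]
    refine Finset.sum_congr rfl fun P hP => ?_
    split_ifs
    · nth_rewrite 1 [← Finset.union_sdiff_of_subset (Finset.mem_powerset.1 hP)]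
      rw [crossWeight_union_left w Finset.disjoint_sdiff]
      ring
    · simp
  have h2 : ∑ A ∈ S.powerset, ∑ P ∈ A.powerset, (if a ∈ P ∧ b ∈ A \ P then treeSum w P *
        (crossWeight w (A \ P) (S \ A) * (treeSum w (A \ P) * treeSum w (S \ A))) else 0) =
      ∑ P ∈ S.powerset, if a ∈ P ∧ b ∈ S \ P then
        (((S \ P).card - 1 : ℕ) : NNReal) * (treeSum w P * treeSum w (S \ P)) else 0 := by
    rw [sum_powerset_powerset_assoc S (fun P Q D => if a ∈ P ∧ b ∈ Q then treeSum w P *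
        (crossWeight w Q D * (treeSum w Q * treeSum w D)) else 0)]
    refine Finset.sum_congr rfl fun P _ => ?_
    by_cases haP : a ∈ P
    · by_cases hbP : b ∈ S \ P
      · rw [if_pos ⟨haP, hbP⟩, mul_left_comm, card_sub_one_mul_treeSum w hbP, Finset.mul_sum]
        refine Finset.sum_congr rfl fun Q _ => ?_
        simp [haP]
      · rw [if_neg (by tauto)]
        refine Finset.sum_eq_zero fun Q hQ => if_neg fun h => hbP (Finset.mem_powerset.1 hQ h.2)
    · simp [haP]
  have h3 : ∑ A ∈ S.powerset, ∑ P ∈ A.powerset, (if a ∈ P ∧ b ∈ A \ P then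
        crossWeight w P (S \ A) * (treeSum w P * treeSum w (S \ A)) * treeSum w (A \ P) else 0) =
      ∑ P ∈ S.powerset, if a ∈ P ∧ b ∈ S \ P then
        ((P.card - 1 : ℕ) : NNReal) * (treeSum w P * treeSum w (S \ P)) else 0 := by
    have hswap : ∀ A ∈ S.powerset, ∑ P ∈ A.powerset, (if a ∈ P ∧ b ∈ A \ P then
        crossWeight w P (S \ A) * (treeSum w P * treeSum w (S \ A)) * treeSum w (A \ P) else 0) =
        ∑ P ∈ A.powerset, (if a ∈ A \ P ∧ b ∈ P then
        crossWeight w (A \ P) (S \ A) * (treeSum w (A \ P) * treeSum w (S \ A)) *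
          treeSum w P else 0) := fun A _ =>
      sum_powerset_sdiff_swap A (fun P Q => if a ∈ P ∧ b ∈ Q then
        crossWeight w P (S \ A) * (treeSum w P * treeSum w (S \ A)) * treeSum w Q else 0)
    rw [Finset.sum_congr rfl hswap,
      sum_powerset_powerset_assoc S (fun P Q D => if a ∈ Q ∧ b ∈ P then
        crossWeight w Q D * (treeSum w Q * treeSum w D) * treeSum w P else 0),
      sum_powerset_sdiff_swap S (fun P Q => if a ∈ P ∧ b ∈ Q then
        ((P.card - 1 : ℕ) : NNReal) * (treeSum w P * treeSum w Q) else 0)]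
    refine Finset.sum_congr rfl fun P _ => ?_
    by_cases hbP : b ∈ P
    · by_cases haP : a ∈ S \ P
      · rw [if_pos ⟨haP, hbP⟩, ← mul_assoc, card_sub_one_mul_treeSum w haP, Finset.sum_mul]
        refine Finset.sum_congr rfl fun Q _ => ?_
        simp [hbP]
      · rw [if_neg (by tauto)]
        refine Finset.sum_eq_zero fun Q hQ => if_neg fun h => haP (Finset.mem_powerset.1 hQ h.1)
    · simp [hbP]
  rw [h1, h2, h3, ← Finset.sum_add_distrib, splitSum, Finset.mul_sum]
  refine Finset.sum_congr rfl fun P hP => ?_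
  split_ifs with h
  · rw [← add_mul, ← Nat.cast_add]
    have hPS := Finset.card_sdiff_add_card_eq_card (Finset.mem_powerset.1 hP)
    have hP1 := Finset.card_pos.2 ⟨a, h.1⟩
    have hP2 := Finset.card_pos.2 ⟨b, h.2⟩
    congr 2
    omega
  · simp

lemma treeSum_congr {w w' : Sym2 α → NNReal} {S : Finset α}
    (h : ∀ i ∈ S, ∀ j ∈ S, i ≠ j → w s(i, j) = w' s(i, j)) : treeSum w S = treeSum w' S := by
  induction S using Finset.strongInduction with
  | H S ih =>
    by_cases hS : S.card = 1
    · rw [treeSum_of_card_eq_one w hS, treeSum_of_card_eq_one w' hS]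
    rw [treeSum_of_card_ne_one w hS, treeSum_of_card_ne_one w' hS]
    congr 1
    refine Finset.sum_congr rfl fun A hA => ?_
    rw [Finset.mem_powerset] at hA
    rw [crossWeight_congr (w := w) (w' := w') (A := A) (B := S \ A) fun i hi j hj =>
      h i (hA hi) j (Finset.mem_sdiff.1 hj).1
        fun hij => (Finset.mem_sdiff.1 hj).2 (hij ▸ hi)]
    rcases A.eq_empty_or_nonempty with rfl | hne
    · simp [crossWeight]
    rcases hA.eq_or_ssubset with rfl | hlt
    · simp [crossWeight]
    rw [ih A hlt fun i hi j hj => h i (hA hi) j (hA hj),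
      ih (S \ A) (Finset.sdiff_ssubset hA hne) fun i hi j hj =>
        h i (Finset.sdiff_subset hi) j (Finset.sdiff_subset hj)]

lemma crossWeight_update {w : Sym2 α → NNReal} {a b : α} (hw : w s(a, b) = 0)
    (s : NNReal) {A B : Finset α} (ha : a ∈ A) (hb : b ∈ B) (hAB : Disjoint A B) :
    crossWeight (Function.update w s(a, b) s) A B = crossWeight w A B + s := by
  have haB : a ∉ B := Finset.disjoint_left.1 hAB ha
  have key : ∀ i ∈ A, ∀ j ∈ B, Function.update w s(a, b) s s(i, j) =
      w s(i, j) + if i = a then (if j = b then s else 0) else 0 := by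
    intro i hi j hj
    by_cases h : s(i, j) = s(a, b)
    · rw [h, Function.update_self, hw]
      rw [Sym2.eq_iff] at h
      rcases h with ⟨rfl, rfl⟩ | ⟨rfl, rfl⟩
      · simp
      · exact absurd hj haB
    · rw [Function.update_of_ne h]
      split_ifs with h1 h2
      · subst h1 h2; exact absurd rfl h
      · simp
      · simp
  unfold crossWeight
  rw [Finset.sum_congr rfl fun i hi => Finset.sum_congr rfl (key i hi)]
  simp [Finset.sum_add_distrib, ha, hb]

lemma treeSum_update {w : Sym2 α → NNReal} {a b : α} (hab : a ≠ b) (hw : w s(a, b) = 0)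
    (s : NNReal) (S : Finset α) :
    treeSum (Function.update w s(a, b) s) S =
      treeSum w S + s * splitSum (treeSum w) a b S := by
  induction S using Finset.strongInduction with
  | H S ih =>
    by_cases hS : a ∈ S ∧ b ∈ S
    swap
    · rw [splitSum_eq_zero _ hS, mul_zero, add_zero]
      refine treeSum_congr fun i hi j hj _ => Function.update_of_ne ?_ _ _
      rw [Ne, Sym2.eq_iff]
      rintro (⟨rfl, rfl⟩ | ⟨rfl, rfl⟩) <;> tauto
    obtain ⟨ha, hb⟩ := hS
    have hcard : 1 < S.card := Finset.one_lt_card.2 ⟨a, ha, b, hb, hab⟩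
    have hne : ((S.card - 1 : ℕ) : NNReal) ≠ 0 := by
      rw [Nat.cast_ne_zero]; omega
    apply mul_left_cancel₀ hne
    rw [mul_add, card_sub_one_mul_treeSum _ ha, card_sub_one_mul_treeSum _ ha]
    have hterm : ∀ A ∈ S.powerset,
        (if a ∈ A then crossWeight (Function.update w s(a, b) s) A (S \ A) *
          (treeSum (Function.update w s(a, b) s) A *
            treeSum (Function.update w s(a, b) s) (S \ A)) else 0) =
        (if a ∈ A then crossWeight w A (S \ A) * (treeSum w A * treeSum w (S \ A)) else 0) +
        s * (crossWeight w A (S \ A) * (splitSum (treeSum w) a b A * treeSum w (S \ A))) +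
        s * (if a ∈ A ∧ b ∈ S \ A then treeSum w A * treeSum w (S \ A) else 0) := by
      intro A hA
      rw [Finset.mem_powerset] at hA
      by_cases haA : a ∈ A
      swap
      · rw [splitSum_eq_zero (S := A) _ (by tauto)]; simp [haA]
      have hlt : S \ A ⊂ S := Finset.sdiff_ssubset hA ⟨a, haA⟩
      rw [if_pos haA, if_pos haA, ih _ hlt,
        splitSum_eq_zero (S := S \ A) _ (fun h => (Finset.mem_sdiff.1 h.1).2 haA)]
      rcases hA.eq_or_ssubset with rfl | hAlt
      · simp [crossWeight]
      rw [ih A hAlt]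
      by_cases hbA : b ∈ A
      · rw [if_neg (by simp [hbA]), crossWeight_congr (w' := w)]
        · ring
        · intro i hi j hj
          refine Function.update_of_ne ?_ _ _
          rw [Ne, Sym2.eq_iff]
          rw [Finset.mem_sdiff] at hj
          rintro (⟨rfl, rfl⟩ | ⟨rfl, rfl⟩) <;> tauto
      · have hbS : b ∈ S \ A := by simp [hb, hbA]
        rw [if_pos ⟨haA, hbS⟩, crossWeight_update hw s haA hbS Finset.disjoint_sdiff,
          splitSum_eq_zero (S := A) _ (by tauto)]
        ring
    rw [Finset.sum_congr rfl hterm, Finset.sum_add_distrib, Finset.sum_add_distrib,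
      ← Finset.mul_sum, ← Finset.mul_sum, sum_crossWeight_mul_splitSum w S a b]
    have hc : ((S.card - 1 : ℕ) : NNReal) = ((S.card - 2 : ℕ) : NNReal) + 1 := by
      rw [← Nat.cast_add_one]; congr 1; omega
    rw [hc, splitSum]
    ring

end TreeSum

section ConnectedSum

variable {α : Type*}

lemma adj_fromEdgeSet {E : Finset (Sym2 α)} {i j : α} :
    (SimpleGraph.fromEdgeSet (E : Set (Sym2 α))).Adj i j ↔ s(i, j) ∈ E ∧ i ≠ j := by
  simp

open scoped Classical in
/-- The vertices in `S` that are connected with `r` by edges in `E`. -/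
def componentIn (E : Finset (Sym2 α)) (S : Finset α) (r : α) : Finset α :=
  S.filter fun i => (SimpleGraph.fromEdgeSet (E : Set (Sym2 α))).Reachable r i

lemma mem_componentIn {E : Finset (Sym2 α)} {S : Finset α} {r i : α} :
    i ∈ componentIn E S r ↔
      i ∈ S ∧ (SimpleGraph.fromEdgeSet (E : Set (Sym2 α))).Reachable r i := by
  simp [componentIn]

variable [DecidableEq α]

/-- The edges of the complete graph on the vertex set `S`. -/
def edgesOn (S : Finset α) : Finset (Sym2 α) := S.sym2.filter fun e => ¬e.IsDiag

lemma mk_mem_edgesOn {S : Finset α} {i j : α} :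
    s(i, j) ∈ edgesOn S ↔ i ∈ S ∧ j ∈ S ∧ i ≠ j := by
  simp [edgesOn, and_assoc]

lemma edgesOn_mono {A S : Finset α} (h : A ⊆ S) : edgesOn A ⊆ edgesOn S :=
  Finset.filter_subset_filter _ (Finset.sym2_mono h)

lemma disjoint_edgesOn {A B : Finset α} (h : Disjoint A B) :
    Disjoint (edgesOn A) (edgesOn B) := by
  rw [Finset.disjoint_left]
  intro e
  induction e with
  | h i j =>
    rw [mk_mem_edgesOn, mk_mem_edgesOn]
    exact fun h1 h2 => Finset.disjoint_left.1 h h1.1 h2.1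

lemma edgesOn_empty : edgesOn (∅ : Finset α) = ∅ := by simp [edgesOn]

/-- The edges in `E` connect all the vertices of the nonempty set `S`. -/
def ConnectsOn (E : Finset (Sym2 α)) (S : Finset α) : Prop :=
  S.Nonempty ∧ ∀ i ∈ S, ∀ j ∈ S, (SimpleGraph.fromEdgeSet (E : Set (Sym2 α))).Reachable i j

open scoped Classical in
/-- The sum over the connected graphs on the vertex set `S` of the product of the edge factors. -/
def connSum (f : Sym2 α → ℝ) (S : Finset α) : ℝ :=
  ∑ E ∈ (edgesOn S).powerset.filter (fun E => ConnectsOn E S), ∏ e ∈ E, f e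

/-- The sum over all graphs on the vertex set `S` of the product of the edge factors. -/
def graphSum (f : Sym2 α → ℝ) (S : Finset α) : ℝ := ∏ e ∈ edgesOn S, (1 + f e)

lemma inter_union_inter_componentIn {E : Finset (Sym2 α)} {S : Finset α} (hE : E ⊆ edgesOn S)
    (r : α) : (E ∩ edgesOn (componentIn E S r)) ∪ (E ∩ edgesOn (S \ componentIn E S r)) = E := by
  rw [← Finset.inter_union_distrib_left, Finset.inter_eq_left]
  intro e he
  induction e with
  | h i j =>
    obtain ⟨hi, hj, hij⟩ := mk_mem_edgesOn.1 (hE he)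
    have hadj := (adj_fromEdgeSet.2 ⟨he, hij⟩).reachable
    simp only [Finset.mem_union, mk_mem_edgesOn, Finset.mem_sdiff, mem_componentIn, hi, hj, hij,
      true_and, ne_eq, not_false_eq_true, and_true]
    by_cases h : (SimpleGraph.fromEdgeSet (E : Set (Sym2 α))).Reachable r i
    · exact Or.inl ⟨h, h.trans hadj⟩
    · exact Or.inr ⟨h, fun h' => h (h'.trans hadj.symm)⟩

lemma connectsOn_inter_componentIn {E : Finset (Sym2 α)} {S : Finset α} (hE : E ⊆ edgesOn S)
    {r : α} (hr : r ∈ S) :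
    ConnectsOn (E ∩ edgesOn (componentIn E S r)) (componentIn E S r) := by
  have key : ∀ i, (SimpleGraph.fromEdgeSet (E : Set (Sym2 α))).Reachable r i →
      (SimpleGraph.fromEdgeSet
        ((E ∩ edgesOn (componentIn E S r) : Finset (Sym2 α)) : Set (Sym2 α))).Reachable r i := by
    intro i hi
    rw [SimpleGraph.reachable_iff_reflTransGen] at hi
    induction hi with
    | refl => rfl
    | @tail j k hj hjk ih =>
      refine ih.trans (SimpleGraph.Adj.reachable ?_)
      rw [← SimpleGraph.reachable_iff_reflTransGen] at hj
      obtain ⟨hmem, hne⟩ := adj_fromEdgeSet.1 hjk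
      obtain ⟨hjS, hkS, -⟩ := mk_mem_edgesOn.1 (hE hmem)
      exact adj_fromEdgeSet.2 ⟨Finset.mem_inter.2 ⟨hmem, mk_mem_edgesOn.2
        ⟨mem_componentIn.2 ⟨hjS, hj⟩, mem_componentIn.2 ⟨hkS, hj.trans hjk.reachable⟩, hne⟩⟩, hne⟩
  refine ⟨⟨r, mem_componentIn.2 ⟨hr, by rfl⟩⟩, fun i hi j hj => ?_⟩
  exact (key i (mem_componentIn.1 hi).2).symm.trans (key j (mem_componentIn.1 hj).2)

lemma componentIn_union {E F : Finset (Sym2 α)} {A S : Finset α} (hA : A ⊆ S)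
    (hE : E ⊆ edgesOn A) (hconn : ConnectsOn E A) (hF : F ⊆ edgesOn (S \ A)) {r : α}
    (hr : r ∈ A) : componentIn (E ∪ F) S r = A := by
  ext i
  rw [mem_componentIn]
  constructor
  · rintro ⟨-, hi⟩
    rw [SimpleGraph.reachable_iff_reflTransGen] at hi
    induction hi with
    | refl => exact hr
    | @tail j k hj hjk ih =>
      rcases Finset.mem_union.1 (adj_fromEdgeSet.1 hjk).1 with h | h
      · exact (mk_mem_edgesOn.1 (hE h)).2.1
      · exact absurd ih (Finset.mem_sdiff.1 (mk_mem_edgesOn.1 (hF h)).1).2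
  · intro hi
    refine ⟨hA hi, (hconn.2 r hr i hi).mono (SimpleGraph.fromEdgeSet_mono ?_)⟩
    exact_mod_cast Finset.subset_union_left

lemma graphSum_eq_sum_connSum (f : Sym2 α → ℝ) {S : Finset α} {r : α} (hr : r ∈ S) :
    graphSum f S =
      ∑ A ∈ S.powerset, if r ∈ A then connSum f A * graphSum f (S \ A) else 0 := by
  classical
  rw [← Finset.sum_filter]
  simp only [graphSum, connSum, Finset.prod_one_add, Finset.sum_mul_sum]
  rw [Finset.sum_congr rfl fun A _ => (Finset.sum_product' _ _ _).symm, Finset.sum_sigma']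
  refine Finset.sum_nbij'
    (fun E => ⟨componentIn E S r, E ∩ edgesOn (componentIn E S r),
      E ∩ edgesOn (S \ componentIn E S r)⟩) (fun z => z.2.1 ∪ z.2.2) ?_ ?_ ?_ ?_ ?_
  · intro E hE
    rw [Finset.mem_powerset] at hE
    simp only [Finset.mem_sigma, Finset.mem_filter, Finset.mem_powerset, Finset.mem_product,
      Finset.inter_subset_right, and_true, true_and]
    exact ⟨⟨Finset.filter_subset _ _, mem_componentIn.2 ⟨hr, by rfl⟩⟩,
      connectsOn_inter_componentIn hE hr⟩
  · rintro ⟨A, E, F⟩ h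
    simp only [Finset.mem_sigma, Finset.mem_filter, Finset.mem_powerset,
      Finset.mem_product] at h ⊢
    exact Finset.union_subset (h.2.1.1.trans (edgesOn_mono h.1.1))
      (h.2.2.trans (edgesOn_mono Finset.sdiff_subset))
  · intro E hE
    exact inter_union_inter_componentIn (Finset.mem_powerset.1 hE) r
  · rintro ⟨A, E, F⟩ h
    simp only [Finset.mem_sigma, Finset.mem_filter, Finset.mem_powerset,
      Finset.mem_product] at h
    have hdisj := disjoint_edgesOn (Finset.disjoint_sdiff (s := A) (t := S))
    have h1 : E ∩ edgesOn (S \ A) = ∅ :=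
      Finset.disjoint_iff_inter_eq_empty.1 (hdisj.mono_left h.2.1.1)
    have h2 : F ∩ edgesOn A = ∅ :=
      Finset.disjoint_iff_inter_eq_empty.1 (hdisj.symm.mono_left h.2.2)
    simp only [componentIn_union h.1.1 h.2.1.1 h.2.1.2 h.2.2 h.1.2, Finset.union_inter_distrib_right,
      h1, h2, Finset.inter_eq_left.2 h.2.1.1, Finset.inter_eq_left.2 h.2.2, Finset.union_empty,
      Finset.empty_union]
  · intro E hE
    have hdisj := disjoint_edgesOn (Finset.disjoint_sdiff (s := componentIn E S r) (t := S))
    conv_lhs => rw [← inter_union_inter_componentIn (Finset.mem_powerset.1 hE) r]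
    exact Finset.prod_union (hdisj.mono Finset.inter_subset_right Finset.inter_subset_right)

lemma connSum_congr {f f' : Sym2 α → ℝ} {S : Finset α} (h : ∀ e ∈ edgesOn S, f e = f' e) :
    connSum f S = connSum f' S := by
  classical
  refine Finset.sum_congr rfl fun E hE => Finset.prod_congr rfl fun e he => h e ?_
  exact Finset.mem_powerset.1 (Finset.mem_filter.1 hE).1 he

lemma connSum_empty (f : Sym2 α → ℝ) : connSum f ∅ = 0 := by
  classical
  exact Finset.sum_eq_zero fun E hE => by simpa using (Finset.mem_filter.1 hE).2.1

lemma connSum_singleton (f : Sym2 α → ℝ) (i : α) : connSum f {i} = 1 := by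
  have h := graphSum_eq_sum_connSum f (Finset.mem_singleton_self i)
  rw [← Finset.sum_filter] at h
  have h1 : ({i} : Finset α).powerset.filter (fun A => i ∈ A) = {{i}} := by
    ext A
    simp only [Finset.mem_filter, Finset.mem_powerset, Finset.mem_singleton,
      Finset.subset_singleton_iff]
    constructor
    · rintro ⟨rfl | rfl, h⟩
      · simp at h
      · rfl
    · rintro rfl; simp
  have h2 : edgesOn ({i} : Finset α) = ∅ := by
    ext e
    induction e with
    | h j k => simp only [mk_mem_edgesOn]; aesop
  rw [h1] at h
  simpa [graphSum, h2, edgesOn_empty] using h.symm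

lemma connSum_zero_of_one_lt_card {S : Finset α} (h : 1 < S.card) :
    connSum (fun _ => 0) S = 0 := by
  classical
  refine Finset.sum_eq_zero fun E hE => ?_
  obtain ⟨i, hi, j, hj, hij⟩ := Finset.one_lt_card.1 h
  have hr := (Finset.mem_filter.1 hE).2.2 i hi j hj
  rcases E.eq_empty_or_nonempty with rfl | ⟨e, he⟩
  · simp at hr
    exact absurd hr hij
  · exact Finset.prod_eq_zero he rfl

/-- A set function is determined on the sets containing `a` by its convolution with `Z`. -/
lemma eq_of_sum_mul_sdiff_eq {F F' Z : Finset α → ℝ} (hZ : Z ∅ = 1) {a : α}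
    (h : ∀ S : Finset α, a ∈ S → ∑ A ∈ S.powerset, (if a ∈ A then F A * Z (S \ A) else 0) =
      ∑ A ∈ S.powerset, (if a ∈ A then F' A * Z (S \ A) else 0))
    {S : Finset α} (ha : a ∈ S) : F S = F' S := by
  induction S using Finset.strongInduction with
  | H S ih =>
    have hS := h S ha
    rw [← Finset.add_sum_erase _ _ (Finset.mem_powerset_self S),
      ← Finset.add_sum_erase _ _ (Finset.mem_powerset_self S)] at hS
    have hrest : ∑ A ∈ S.powerset.erase S, (if a ∈ A then F A * Z (S \ A) else 0) =
        ∑ A ∈ S.powerset.erase S, (if a ∈ A then F' A * Z (S \ A) else 0) := by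
      refine Finset.sum_congr rfl fun A hA => ?_
      rw [Finset.mem_erase, Finset.mem_powerset] at hA
      split_ifs with haA
      · rw [ih A (hA.2.ssubset_of_ne hA.1) haA]
      · rfl
    rw [hrest] at hS
    simpa [ha, hZ] using add_right_cancel hS

lemma graphSum_update {f : Sym2 α → ℝ} {e : Sym2 α} (hf : f e = 0) (s : ℝ) (S : Finset α) :
    graphSum (Function.update f e s) S =
      if e ∈ edgesOn S then (1 + s) * graphSum f S else graphSum f S := by
  unfold graphSum
  split_ifs with he
  · rw [← Finset.mul_prod_erase _ _ he, ← Finset.mul_prod_erase _ _ he]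
    simp only [Function.update_self, hf, add_zero, one_mul]
    congr 1
    exact Finset.prod_congr rfl fun x hx => by
      rw [Function.update_of_ne (Finset.ne_of_mem_erase hx)]
  · exact Finset.prod_congr rfl fun x hx => by
      rw [Function.update_of_ne (ne_of_mem_of_not_mem hx he)]

lemma sum_splitSum_mul_graphSum (f : Sym2 α → ℝ) (S : Finset α) (a b : α) :
    ∑ A ∈ S.powerset, splitSum (connSum f) a b A * graphSum f (S \ A) =
      ∑ P ∈ S.powerset,
        if a ∈ P ∧ b ∈ S \ P then connSum f P * graphSum f (S \ P) else 0 := by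
  have h := sum_powerset_powerset_assoc S (fun P Q D => if a ∈ P ∧ b ∈ Q then
    connSum f P * (connSum f Q * graphSum f D) else 0)
  have hl : ∀ A ∈ S.powerset, splitSum (connSum f) a b A * graphSum f (S \ A) =
      ∑ P ∈ A.powerset, if a ∈ P ∧ b ∈ A \ P then
        connSum f P * (connSum f (A \ P) * graphSum f (S \ A)) else 0 := by
    intro A _
    rw [splitSum, Finset.sum_mul]
    refine Finset.sum_congr rfl fun P _ => ?_
    split_ifs <;> ring
  rw [Finset.sum_congr rfl hl, h]
  refine Finset.sum_congr rfl fun P _ => ?_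
  by_cases haP : a ∈ P
  · by_cases hbP : b ∈ S \ P
    · rw [if_pos ⟨haP, hbP⟩, graphSum_eq_sum_connSum f hbP, Finset.mul_sum]
      refine Finset.sum_congr rfl fun Q _ => ?_
      simp [haP]
    · rw [if_neg (by tauto)]
      exact Finset.sum_eq_zero fun Q hQ => if_neg fun h => hbP (Finset.mem_powerset.1 hQ h.2)
  · simp [haP]

lemma connSum_update {f : Sym2 α → ℝ} {a b : α} (hab : a ≠ b) (hf : f s(a, b) = 0) (s : ℝ)
    {S : Finset α} (ha : a ∈ S) (hb : b ∈ S) :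
    connSum (Function.update f s(a, b) s) S =
      (1 + s) * connSum f S + s * splitSum (connSum f) a b S := by
  have key := eq_of_sum_mul_sdiff_eq (F := connSum (Function.update f s(a, b) s))
    (F' := fun A => connSum f A + s * ((if b ∈ A then connSum f A else 0) +
      splitSum (connSum f) a b A)) (Z := graphSum f) (a := a)
    (by simp [graphSum, edgesOn_empty]) ?_ ha
  · rw [key, if_pos hb]; ring
  intro S ha
  have h1 : ∀ A ∈ S.powerset,
      (if a ∈ A then connSum (Function.update f s(a, b) s) A * graphSum f (S \ A) else 0) =
      if a ∈ A then connSum (Function.update f s(a, b) s) A *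
        graphSum (Function.update f s(a, b) s) (S \ A) else 0 := by
    intro A _
    split_ifs with haA
    · rw [graphSum_update hf, if_neg]
      simp [mk_mem_edgesOn, haA]
    · rfl
  rw [Finset.sum_congr rfl h1, ← graphSum_eq_sum_connSum _ ha, graphSum_update hf]
  have h2 : ∀ A ∈ S.powerset, (if a ∈ A then (connSum f A + s * ((if b ∈ A then connSum f A else 0)
      + splitSum (connSum f) a b A)) * graphSum f (S \ A) else 0) =
      (if a ∈ A then connSum f A * graphSum f (S \ A) else 0) +
      s * (if a ∈ A ∧ b ∈ A then connSum f A * graphSum f (S \ A) else 0) +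
      s * (splitSum (connSum f) a b A * graphSum f (S \ A)) := by
    intro A _
    by_cases haA : a ∈ A
    · by_cases hbA : b ∈ A
      · simp only [haA, hbA, if_true, and_self]; ring
      · simp only [haA, hbA, if_true, if_false, and_false]; ring
    · rw [splitSum_eq_zero _ (by tauto)]; simp [haA]
  rw [Finset.sum_congr rfl h2, Finset.sum_add_distrib, Finset.sum_add_distrib, ← Finset.mul_sum,
    ← Finset.mul_sum, sum_splitSum_mul_graphSum, ← graphSum_eq_sum_connSum f ha, add_assoc,
    ← mul_add, ← Finset.sum_add_distrib]
  by_cases hb : b ∈ S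
  · rw [if_pos (mk_mem_edgesOn.2 ⟨ha, hb, hab⟩), add_mul, one_mul]
    congr 2
    rw [graphSum_eq_sum_connSum f ha]
    refine Finset.sum_congr rfl fun A _ => ?_
    by_cases haA : a ∈ A <;> by_cases hbA : b ∈ A <;> simp [haA, hbA, hb]
  · rw [if_neg (by simp [mk_mem_edgesOn, hb]), Finset.sum_eq_zero]
    · simp
    · intro A hA
      rw [if_neg fun h => hb (Finset.mem_powerset.1 hA h.2),
        if_neg fun h => hb (Finset.mem_sdiff.1 h.2).1, add_zero]

end ConnectedSum

section PointwiseBound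

variable {α : Type*} [DecidableEq α]

/-- The function equal to `f` on `G` and to zero elsewhere. -/
def restrictTo {β R : Type*} [DecidableEq β] [Zero R] (f : β → R) (G : Finset β) : β → R :=
  fun e => if e ∈ G then f e else 0

lemma restrictTo_of_mem {β R : Type*} [DecidableEq β] [Zero R] (f : β → R) {G : Finset β} {e : β}
    (h : e ∈ G) : restrictTo f G e = f e := if_pos h

lemma restrictTo_insert {β R : Type*} [DecidableEq β] [Zero R] (f : β → R) (G : Finset β) (e : β) :
    restrictTo f (insert e G) = Function.update (restrictTo f G) e (f e) := by
  ext x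
  by_cases h : x = e
  · subst h; simp [restrictTo]
  · simp [restrictTo, h]

lemma abs_exp_neg_sub_one (t : ℝ) :
    |exp (-t) - 1| = exp (max (-t) 0) * (1 - exp (-|t|)) := by
  rcases le_total 0 t with h | h
  · rw [abs_of_nonneg h, max_eq_right (by linarith), exp_zero, one_mul, abs_sub_comm,
      abs_of_nonneg]
    linarith [exp_le_one_iff.2 (neg_nonpos.2 h)]
  · rw [abs_of_nonpos h, max_eq_left (by linarith), neg_neg, mul_sub, ← exp_add, mul_one,
      neg_add_cancel, exp_zero, abs_of_nonneg]
    linarith [one_le_exp (neg_nonneg.2 h)]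

variable {v : Sym2 α → ℝ} {w : Sym2 α → NNReal}

/-- Adding one edge preserves bounds of the form `exp (H S) * treeSum w S`, for suitable `H`. -/
lemma abs_connSum_insert_le (hw : ∀ e, 1 - exp (-|v e|) ≤ w e) {G : Finset (Sym2 α)} {e : Sym2 α}
    (hG : e ∉ G) (he : ¬e.IsDiag) {H H' : Finset α → ℝ}
    (h : ∀ S, |connSum (restrictTo (fun e => exp (-v e) - 1) G) S| ≤
      exp (H S) * treeSum (restrictTo w G) S)
    (hmono : ∀ S, e ∉ edgesOn S → H S ≤ H' S)
    (hadd : ∀ S, e ∈ edgesOn S → H S - v e ≤ H' S)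
    (hsplit : ∀ S A, A ⊆ S → e ∈ edgesOn S → e ∉ edgesOn A → e ∉ edgesOn (S \ A) →
      H A + H (S \ A) + max (-v e) 0 ≤ H' S) (S : Finset α) :
    |connSum (restrictTo (fun e => exp (-v e) - 1) (insert e G)) S| ≤
      exp (H' S) * treeSum (restrictTo w (insert e G)) S := by
  rw [restrictTo_insert, restrictTo_insert]
  set f := restrictTo (fun e => exp (-v e) - 1) G with hf
  set u := restrictTo w G with hu
  have hfe : f e = 0 := if_neg hG
  have hue : u e = 0 := if_neg hG
  induction e with
  | h a b =>
  have hab : a ≠ b := by simpa using he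
  rw [treeSum_update hab hue]
  by_cases heS : s(a, b) ∈ edgesOn S
  swap
  · rw [connSum_congr (f' := f) fun x hx =>
      Function.update_of_ne (ne_of_mem_of_not_mem hx heS) _ _]
    refine (h S).trans ?_
    gcongr
    · exact hmono S heS
    · exact le_self_add
  obtain ⟨ha, hb, -⟩ := mk_mem_edgesOn.1 heS
  rw [connSum_update hab hfe _ ha hb]
  push_cast
  rw [mul_add]
  refine (abs_add_le _ _).trans (add_le_add ?_ ?_)
  · rw [add_sub_cancel, abs_mul, abs_exp]
    calc exp (-v s(a, b)) * |connSum f S| ≤ exp (-v s(a, b)) * (exp (H S) * treeSum u S) := by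
          gcongr; exact h S
      _ = exp (H S - v s(a, b)) * treeSum u S := by
          rw [← mul_assoc, ← exp_add, neg_add_eq_sub]
      _ ≤ _ := by gcongr; exact hadd S heS
  · rw [abs_mul, abs_exp_neg_sub_one, splitSum, splitSum, NNReal.coe_sum]
    calc _ ≤ exp (max (-v s(a, b)) 0) * (1 - exp (-|v s(a, b)|)) *
          ∑ A ∈ S.powerset, |if a ∈ A ∧ b ∈ S \ A then connSum f A * connSum f (S \ A) else 0| := by
          gcongr
          · exact mul_nonneg (exp_pos _).le (by simp)
          · exact Finset.abs_sum_le_sum_abs _ _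
      _ ≤ _ := by
          rw [Finset.mul_sum, Finset.mul_sum, Finset.mul_sum]
          refine Finset.sum_le_sum fun A hA => ?_
          split_ifs with hsep
          swap
          · simp
          rw [abs_mul]
          calc _ ≤ exp (max (-v s(a, b)) 0) * w s(a, b) *
                ((exp (H A) * treeSum u A) * (exp (H (S \ A)) * treeSum u (S \ A))) := by
                gcongr
                · exact hw _
                · exact h A
                · exact h (S \ A)
            _ = exp (H A + H (S \ A) + max (-v s(a, b)) 0) *
                (w s(a, b) * (treeSum u A * treeSum u (S \ A))) := by
                rw [exp_add, exp_add]; ring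
            _ ≤ _ := by
                push_cast
                gcongr
                refine hsplit S A (Finset.mem_powerset.1 hA) heS ?_ ?_
                · exact fun h' => (Finset.mem_sdiff.1 hsep.2).2 (mk_mem_edgesOn.1 h').2.1
                · exact fun h' => (Finset.mem_sdiff.1 (mk_mem_edgesOn.1 h').1).2 hsep.1

lemma sum_edgesOn_filter_add_le {g : Sym2 α → ℝ} (p : Sym2 α → Prop) [DecidablePred p]
    (hg : ∀ e, p e → 0 ≤ g e) {A S : Finset α} (hA : A ⊆ S) :
    ∑ e ∈ edgesOn A with p e, g e + ∑ e ∈ edgesOn (S \ A) with p e, g e ≤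
      ∑ e ∈ edgesOn S with p e, g e := by
  rw [← Finset.sum_union (Finset.disjoint_filter_filter
    (disjoint_edgesOn Finset.disjoint_sdiff))]
  refine Finset.sum_le_sum_of_subset_of_nonneg (Finset.union_subset ?_ ?_) ?_
  · exact Finset.filter_subset_filter _ (edgesOn_mono hA)
  · exact Finset.filter_subset_filter _ (edgesOn_mono Finset.sdiff_subset)
  · exact fun e he _ => hg e (Finset.mem_filter.1 he).2

lemma abs_connSum_le_of_neg (hw : ∀ e, 1 - exp (-|v e|) ≤ w e) (G : Finset (Sym2 α))
    (hdiag : ∀ e ∈ G, ¬e.IsDiag) (hneg : ∀ e ∈ G, v e < 0) (S : Finset α) :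
    |connSum (restrictTo (fun e => exp (-v e) - 1) G) S| ≤
      exp (∑ e ∈ edgesOn S with e ∈ G, -v e) * treeSum (restrictTo w G) S := by
  induction G using Finset.induction_on generalizing S with
  | empty =>
    have hf : restrictTo (fun e => exp (-v e) - 1) ∅ = fun _ => 0 := by ext; simp [restrictTo]
    rw [hf]
    rcases Nat.lt_trichotomy S.card 1 with h | h | h
    · have : S = ∅ := by simpa using h
      subst this
      rw [connSum_empty, abs_zero]; positivity
    · rw [treeSum_of_card_eq_one _ h]
      obtain ⟨i, rfl⟩ := Finset.card_eq_one.1 h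
      simp [connSum_singleton]
    · rw [connSum_zero_of_one_lt_card h, abs_zero]; positivity
  | insert e G he ih =>
    have hdG : ∀ e ∈ G, ¬e.IsDiag := fun x hx => hdiag x (Finset.mem_insert_of_mem hx)
    have hnG : ∀ e ∈ G, v e < 0 := fun x hx => hneg x (Finset.mem_insert_of_mem hx)
    have hve : v e < 0 := hneg e (Finset.mem_insert_self _ _)
    have hins : ∀ S : Finset α, e ∈ edgesOn S → ∑ x ∈ edgesOn S with x ∈ insert e G, -v x =
        ∑ x ∈ edgesOn S with x ∈ G, -v x + -v e := by
      intro S heS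
      have : (edgesOn S).filter (· ∈ insert e G) = insert e ((edgesOn S).filter (· ∈ G)) := by
        ext x
        simp only [Finset.mem_filter, Finset.mem_insert]
        constructor
        · rintro ⟨h1, rfl | h2⟩
          · exact Or.inl rfl
          · exact Or.inr ⟨h1, h2⟩
        · rintro (rfl | ⟨h1, h2⟩)
          · exact ⟨heS, Or.inl rfl⟩
          · exact ⟨h1, Or.inr h2⟩
      rw [this, Finset.sum_insert (by simp [he]), add_comm]
    refine abs_connSum_insert_le hw he (hdiag e (Finset.mem_insert_self _ _))
      (H := fun S => ∑ e ∈ edgesOn S with e ∈ G, -v e)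
      (H' := fun S => ∑ x ∈ edgesOn S with x ∈ insert e G, -v x)
      (fun S => ih hdG hnG S) (fun S _ => ?_) (fun S heS => ?_) (fun S A hA heS _ _ => ?_) S
    · refine Finset.sum_le_sum_of_subset_of_nonneg
        (Finset.monotone_filter_right _ fun x _ hx => Finset.mem_insert_of_mem hx) ?_
      exact fun x hx _ => neg_nonneg.2 (hneg x (Finset.mem_filter.1 hx).2).le
    · rw [hins S heS]; linarith
    · rw [hins S heS, max_eq_left (by linarith)]
      gcongr
      exact sum_edgesOn_filter_add_le (· ∈ G) (fun x hx => neg_nonneg.2 (hnG x hx).le) hA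

/-- Pointwise tree-graph bound for an energy that is stable with constant `B`. -/
lemma abs_connSum_le [Fintype α] (hw : ∀ e, 1 - exp (-|v e|) ≤ w e) {B : ℝ}
    (hB : ∀ S : Finset α, -(B * S.card) ≤ ∑ e ∈ edgesOn S, v e) :
    |connSum (fun e => exp (-v e) - 1) Finset.univ| ≤
      exp (B * Fintype.card α) * treeSum w (Finset.univ : Finset α) := by
  set N : Finset (Sym2 α) := (edgesOn Finset.univ).filter (fun e => v e < 0) with hN
  have memN : ∀ {S : Finset α} {e}, e ∈ edgesOn S → (e ∈ N ↔ v e < 0) := fun h => by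
    simp [hN, edgesOn_mono (Finset.subset_univ _) h]
  have key : ∀ P : Finset (Sym2 α), (∀ e ∈ P, ¬e.IsDiag) → (∀ e ∈ P, 0 ≤ v e) →
      ∀ S, |connSum (restrictTo (fun e => exp (-v e) - 1) (P ∪ N)) S| ≤
        exp (B * S.card + ∑ e ∈ edgesOn S with e ∉ P ∪ N, v e) *
          treeSum (restrictTo w (P ∪ N)) S := by
    intro P
    induction P using Finset.induction_on with
    | empty =>
      intro _ _ S
      rw [Finset.empty_union]
      refine (abs_connSum_le_of_neg hw N ?_ ?_ S).trans ?_
      · exact fun e he => (Finset.mem_filter.1 (Finset.mem_filter.1 he).1).2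
      · exact fun e he => (Finset.mem_filter.1 he).2
      · gcongr
        have := hB S
        rw [← Finset.sum_filter_add_sum_filter_not _ (fun e => e ∈ N)] at this
        rw [Finset.sum_neg_distrib]
        linarith
    | insert e P he ih =>
      intro hdiag hpos
      have hve : 0 ≤ v e := hpos e (Finset.mem_insert_self _ _)
      have heN : e ∉ N := fun h => absurd (Finset.mem_filter.1 h).2 (not_lt.2 hve)
      rw [Finset.insert_union]
      have hsame : ∀ S : Finset α, e ∉ edgesOn S →
          ∑ x ∈ edgesOn S with x ∉ insert e (P ∪ N), v x =
          ∑ x ∈ edgesOn S with x ∉ P ∪ N, v x := by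
        intro S heS
        refine Finset.sum_congr (Finset.filter_congr fun x hx => ?_) fun _ _ => rfl
        rw [Finset.mem_insert, not_or, and_iff_right (ne_of_mem_of_not_mem hx heS)]
      refine abs_connSum_insert_le hw (by simp [he, heN])
        (hdiag e (Finset.mem_insert_self _ _))
        (H := fun S => B * S.card + ∑ e ∈ edgesOn S with e ∉ P ∪ N, v e)
        (H' := fun S => B * S.card + ∑ x ∈ edgesOn S with x ∉ insert e (P ∪ N), v x)
        (ih (fun x hx => hdiag x (Finset.mem_insert_of_mem hx))
          fun x hx => hpos x (Finset.mem_insert_of_mem hx)) (fun S heS => ?_) (fun S heS => ?_)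
        (fun S A hA heS heA heA' => ?_)
      · exact (add_left_cancel_iff.2 (hsame S heS).symm).le
      · have : (edgesOn S).filter (· ∉ P ∪ N) =
            insert e ((edgesOn S).filter (· ∉ insert e (P ∪ N))) := by
          ext x
          by_cases hx : x = e
          · subst hx; simp [heS, he, heN]
          · simp [hx]
        simp only [this]
        rw [Finset.sum_insert (by simp)]
        linarith
      · have hle := sum_edgesOn_filter_add_le (g := fun e => max (v e) 0)
          (· ∉ insert e (P ∪ N)) (fun _ _ => le_max_right _ _) hA
        have hmax : ∀ S : Finset α, ∑ x ∈ edgesOn S with x ∉ insert e (P ∪ N), max (v x) 0 =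
            ∑ x ∈ edgesOn S with x ∉ insert e (P ∪ N), v x := by
          intro S
          refine Finset.sum_congr rfl fun x hx => max_eq_left (not_lt.1 fun hlt => ?_)
          rw [Finset.mem_filter] at hx
          exact hx.2 (Finset.mem_insert_of_mem
            (Finset.mem_union_right _ ((memN hx.1).2 hlt)))
        rw [hmax, hmax, hmax, hsame A heA, hsame _ heA'] at hle
        have hcard : (S.card : ℝ) = A.card + (S \ A).card := by
          rw [← Finset.card_sdiff_add_card_eq_card hA]; push_cast; ring
        rw [max_eq_right (by linarith), hcard]
        linarith
  have := key ((edgesOn Finset.univ).filter (fun e => 0 ≤ v e))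
    (fun e he => (Finset.mem_filter.1 (Finset.mem_filter.1 he).1).2)
    (fun e he => (Finset.mem_filter.1 he).2) Finset.univ
  have hall : (edgesOn Finset.univ).filter (fun e => 0 ≤ v e) ∪ N = edgesOn Finset.univ := by
    rw [hN, ← Finset.filter_or, Finset.filter_true_of_mem]
    exact fun e _ => le_or_gt 0 (v e)
  rw [hall, Finset.sum_eq_zero, add_zero] at this
  · rw [connSum_congr (f' := fun e => exp (-v e) - 1) fun e he =>
        restrictTo_of_mem (fun e => exp (-v e) - 1) he,
      treeSum_congr (w' := w) fun i _ j _ hij =>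
        restrictTo_of_mem _ (mk_mem_edgesOn.2 (by simp [hij]))] at this
    exact this
  · exact fun e he => absurd (Finset.mem_filter.1 he).1 (Finset.mem_filter.1 he).2

end PointwiseBound

section AbelIdentity

/-- A case of Abel's binomial identity. -/
lemma sum_choose_mul_pow_mul_pow (m : ℕ) (y : ℝ) :
    ∑ k ∈ Finset.range (m + 1), ((m + 1).choose (k + 1) : ℝ) * ((k : ℝ) + 1) ^ k *
      (y + ((m : ℝ) - k)) ^ (m - k) = (m + 1) * (y + m + 1) ^ m := by
  induction m generalizing y with
  | zero => simp
  | succ m ih =>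
    set F : ℝ → ℝ := fun y => ∑ k ∈ Finset.range (m + 1 + 1), ((m + 1 + 1).choose (k + 1) : ℝ) *
      ((k : ℝ) + 1) ^ k * (y + (((m + 1 : ℕ) : ℝ) - k)) ^ (m + 1 - k) with hF
    set G : ℝ → ℝ := fun y => (((m + 1 : ℕ) : ℝ) + 1) * (y + ((m + 1 : ℕ) : ℝ) + 1) ^ (m + 1) with hG
    have hFd : ∀ y, HasDerivAt F (((m : ℝ) + 2) * ((m + 1) * (y + 1 + m + 1) ^ m)) y := by
      intro y
      rw [← ih (y + 1)]
      have h1 : HasDerivAt F (∑ k ∈ Finset.range (m + 1 + 1), ((m + 1 + 1).choose (k + 1) : ℝ) *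
          ((k : ℝ) + 1) ^ k * (((m + 1 - k : ℕ) : ℝ) *
            (y + (((m + 1 : ℕ) : ℝ) - k)) ^ (m + 1 - k - 1) * 1)) y :=
        HasDerivAt.fun_sum fun k _ =>
          (((hasDerivAt_id y).add_const _).pow _).const_mul _
      convert h1 using 1
      rw [Finset.sum_range_succ _ (m + 1), Nat.sub_self, Nat.cast_zero, zero_mul, zero_mul,
        mul_zero, add_zero, Finset.mul_sum]
      refine Finset.sum_congr rfl fun k hk => ?_
      have hk' : k ≤ m := Nat.lt_succ_iff.1 (Finset.mem_range.1 hk)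
      have hc : ((m : ℝ) + 2) * ((m + 1).choose (k + 1) : ℝ) =
          ((m + 1 + 1).choose (k + 1) : ℝ) * ((m + 1 - k : ℕ) : ℝ) := by
        have := Nat.choose_mul_succ_eq (m + 1) (k + 1)
        rw [show m + 1 + 1 - (k + 1) = m + 1 - k by omega] at this
        have h2 : (((m + 1).choose (k + 1) * (m + 1 + 1) : ℕ) : ℝ) =
          (((m + 1 + 1).choose (k + 1) * (m + 1 - k) : ℕ) : ℝ) := by exact_mod_cast this
        rw [Nat.cast_mul, Nat.cast_mul] at h2
        rw [← h2]; push_cast; ring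
      rw [show m + 1 - k - 1 = m - k by omega]
      push_cast
      rw [show y + ((m : ℝ) + 1 - k) = y + 1 + (m - k) by ring]
      linear_combination ((k : ℝ) + 1) ^ k * (y + 1 + ((m : ℝ) - k)) ^ (m - k) * hc
    have hGd : ∀ y, HasDerivAt G (((m : ℝ) + 2) * ((m + 1) * (y + 1 + m + 1) ^ m)) y := by
      intro y
      have h1 : HasDerivAt G ((((m + 1 : ℕ) : ℝ) + 1) * (((m + 1 : ℕ) : ℝ) *
          (y + ((m + 1 : ℕ) : ℝ) + 1) ^ (m + 1 - 1) * 1)) y :=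
        ((((hasDerivAt_id y).add_const _).add_const 1).pow (m + 1)).const_mul _
      convert h1 using 1
      rw [Nat.add_sub_cancel]
      push_cast
      ring
    have hconst := is_const_of_deriv_eq_zero (f := F - G)
      (fun y => ((hFd y).sub (hGd y)).differentiableAt)
      (fun y => by rw [((hFd y).sub (hGd y)).deriv, sub_self])
    have hF0 : F (-((m : ℝ) + 2)) = 0 := by
      have h0 := congrFun (fwdDiff_iter_pow_eq_zero_of_lt (R := ℝ) (Nat.lt_succ_self (m + 1))) 0
      rw [fwdDiff_iter_eq_sum_shift, Finset.sum_range_succ'] at h0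
      simp only [Pi.zero_apply] at h0
      rw [hF]
      simp only
      rw [← h0]
      have hz : ((-1 : ℤ) ^ (m + 1 + 1 - 0) * ((m + 1 + 1).choose 0 : ℤ)) •
        (0 + 0 • (1 : ℝ)) ^ (m + 1) = 0 := by simp
      rw [hz, add_zero]
      refine Finset.sum_congr rfl fun k hk => ?_
      have hk' : k ≤ m + 1 := Nat.lt_succ_iff.1 (Finset.mem_range.1 hk)
      rw [show m + 1 + 1 - (k + 1) = m + 1 - k by omega, zsmul_eq_mul]
      have hp : ((k : ℝ) + 1) ^ (m + 1) = ((k : ℝ) + 1) ^ k * ((k : ℝ) + 1) ^ (m + 1 - k) := by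
        rw [← pow_add]; congr 1; omega
      push_cast
      rw [show -((m : ℝ) + 2) + (m + 1 - k) = (-1) * (k + 1) by ring, mul_pow, nsmul_one, zero_add]
      push_cast
      rw [hp]
      ring
    have hG0 : G (-((m : ℝ) + 2)) = 0 := by
      rw [hG]
      simp only
      rw [show -((m : ℝ) + 2) + ((m + 1 : ℕ) : ℝ) + 1 = 0 by push_cast; ring, zero_pow (by omega),
        mul_zero]
    have := hconst y (-((m : ℝ) + 2))
    simp only [Pi.sub_apply, hF0, hG0, sub_zero] at this
    exact sub_eq_zero.1 this

lemma sum_choose_mul_pow_sub_two (m : ℕ) (hm : 1 ≤ m) :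
    ∑ k ∈ Finset.range (m + 1), m.choose k *
      ((k * k ^ (k - 2)) * ((m - k) * (m - k) ^ (m - k - 2))) = 2 * (m - 1) * m ^ (m - 2) := by
  obtain ⟨n, rfl⟩ : ∃ n, m = n + 1 := ⟨m - 1, by omega⟩
  set c : ℕ → ℝ := fun k => (k : ℝ) * (k : ℝ) ^ (k - 2) with hc
  have hc1 : ∀ k : ℕ, c (k + 1) = ((k : ℝ) + 1) ^ k := by
    intro k
    rcases k with _ | k
    · simp [hc]
    · simp only [hc]
      rw [show k + 1 + 1 - 2 = k by omega, ← pow_succ']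
      push_cast; ring
  set s : ℝ := ∑ k ∈ Finset.range (n + 1 + 1), ((n + 1).choose k : ℝ) * (c k * c (n + 1 - k))
    with hs
  have hmul : ((n : ℝ) + 1) * s = 2 * ∑ k ∈ Finset.range (n + 1 + 1),
      ((n + 1).choose k : ℝ) * (c k * (((n + 1 - k : ℕ) : ℝ) * c (n + 1 - k))) := by
    have hrefl : ∑ k ∈ Finset.range (n + 1 + 1),
        ((n + 1).choose k : ℝ) * (c k * (((n + 1 - k : ℕ) : ℝ) * c (n + 1 - k))) =
        ∑ k ∈ Finset.range (n + 1 + 1),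
        ((n + 1).choose k : ℝ) * (c (n + 1 - k) * ((k : ℝ) * c k)) := by
      rw [← Finset.sum_range_reflect]
      refine Finset.sum_congr rfl fun k hk => ?_
      have hk' : k ≤ n + 1 := Nat.lt_succ_iff.1 (Finset.mem_range.1 hk)
      rw [show n + 1 + 1 - 1 - k = n + 1 - k by omega, show n + 1 - (n + 1 - k) = k by omega,
        Nat.choose_symm hk']
    rw [two_mul]
    nth_rewrite 1 [hrefl]
    rw [← Finset.sum_add_distrib, hs, Finset.mul_sum]
    refine Finset.sum_congr rfl fun k hk => ?_
    have hk' : k ≤ n + 1 := Nat.lt_succ_iff.1 (Finset.mem_range.1 hk)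
    rw [Nat.cast_sub hk']
    push_cast
    ring
  have habel := sum_choose_mul_pow_mul_pow n 0
  have hsum : ∑ k ∈ Finset.range (n + 1 + 1),
      ((n + 1).choose k : ℝ) * (c k * (((n + 1 - k : ℕ) : ℝ) * c (n + 1 - k))) =
      ((n : ℝ) + 1) * (n + 1) ^ n - (n + 1) ^ n := by
    have h0 : c 0 = 0 := by simp [hc]
    rw [Finset.sum_range_succ', h0, zero_mul, mul_zero, add_zero, Finset.sum_range_succ]
    rw [Finset.sum_range_succ] at habel
    simp only [zero_add, Nat.sub_self, sub_self, pow_zero, mul_one, Nat.choose_self,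
      Nat.cast_one, one_mul, Nat.cast_zero, zero_mul, mul_zero, add_zero] at habel ⊢
    rw [← habel, add_sub_cancel_right]
    refine Finset.sum_congr rfl fun k hk => ?_
    have hk' : k < n := Finset.mem_range.1 hk
    obtain ⟨d, rfl⟩ : ∃ d, n = k + d + 1 := ⟨n - k - 1, by omega⟩
    rw [show k + d + 1 + 1 - (k + 1) = d + 1 by omega, show k + d + 1 - k = d + 1 by omega, hc1, hc1]
    push_cast
    ring
  rw [hsum] at hmul
  have hn : ((n : ℝ) + 1) ≠ 0 := by positivity
  have hfin : s = 2 * n * ((n : ℝ) + 1) ^ (n - 1) := by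
    apply mul_left_cancel₀ hn
    rw [hmul]
    rcases n with _ | n
    · simp
    · rw [Nat.add_sub_cancel]; push_cast; ring
  have : (((∑ k ∈ Finset.range (n + 1 + 1), (n + 1).choose k *
      ((k * k ^ (k - 2)) * ((n + 1 - k) * (n + 1 - k) ^ (n + 1 - k - 2))) : ℕ)) : ℝ) =
      ((2 * (n + 1 - 1) * (n + 1) ^ (n + 1 - 2) : ℕ) : ℝ) := by
    rw [Nat.add_sub_cancel, show n + 1 - 2 = n - 1 by omega]
    push_cast [-Nat.cast_sub]
    rw [← hfin, hs]
  exact_mod_cast this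

end AbelIdentity

section TreeIntegral

open scoped ENNReal

lemma lmarginal_mul_left_of_congr {ι : Type*} [DecidableEq ι] {X : ι → Type*}
    [∀ i, MeasurableSpace (X i)] (μ : ∀ i, Measure (X i)) {s : Finset ι}
    {φ f : (∀ i, X i) → ℝ≥0∞} (hφ : ∀ x y, (∀ i ∉ s, x i = y i) → φ x = φ y)
    (hf : Measurable f) (x : ∀ i, X i) :
    (∫⋯∫⁻_s, (fun x => φ x * f x) ∂μ) x = φ x * (∫⋯∫⁻_s, f ∂μ) x := by
  unfold lmarginal
  have hm : Measurable fun y : ∀ i : s, X i => f (Function.updateFinset x s y) :=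
    hf.comp measurable_updateFinset
  rw [← lintegral_const_mul _ hm]
  refine lintegral_congr fun y => ?_
  beta_reduce
  rw [hφ (Function.updateFinset x s y) x fun i hi => by simp [Function.updateFinset, hi]]

variable {α : Type*}

/-- The edge weights `g (|x i - x j|)` of a configuration `x`. -/
def distWeight (g : ℝ → NNReal) (x : α → E3) : Sym2 α → NNReal :=
  Sym2.lift ⟨fun i j => g ‖x i - x j‖, fun i j => by simp only [norm_sub_rev (x i)]⟩

lemma distWeight_mk (g : ℝ → NNReal) (x : α → E3) (i j : α) :
    distWeight g x s(i, j) = g ‖x i - x j‖ := rfl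

variable {g : ℝ → NNReal}

lemma measurable_distWeight (hg : Measurable g) (i j : α) :
    Measurable fun x : α → E3 => distWeight g x s(i, j) := by
  simp only [distWeight_mk]
  exact hg.comp ((measurable_pi_apply i).sub (measurable_pi_apply j)).norm

variable [DecidableEq α]

lemma treeSum_distWeight_congr {x y : α → E3} {S : Finset α} (h : ∀ i ∈ S, x i = y i) :
    treeSum (distWeight g x) S = treeSum (distWeight g y) S :=
  treeSum_congr fun i hi j hj _ => by rw [distWeight_mk, distWeight_mk, h i hi, h j hj]

lemma measurable_treeSum_distWeight (hg : Measurable g) (S : Finset α) :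
    Measurable fun x : α → E3 => treeSum (distWeight g x) S := by
  induction S using Finset.strongInduction with
  | H S ih =>
    by_cases hS : S.card = 1
    · simp only [treeSum_of_card_eq_one _ hS, measurable_const]
    simp only [treeSum_of_card_ne_one _ hS]
    refine Measurable.const_mul (Finset.measurable_fun_sum _ fun A hA => ?_) _
    rw [Finset.mem_powerset] at hA
    rcases A.eq_empty_or_nonempty with rfl | hne
    · simp [crossWeight]
    rcases hA.eq_or_ssubset with rfl | hlt
    · simp [crossWeight]
    refine Measurable.mul ?_ ((ih A hlt).mul (ih _ (Finset.sdiff_ssubset hA hne)))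
    exact Finset.measurable_fun_sum _ fun i _ => Finset.measurable_fun_sum _ fun j _ =>
      measurable_distWeight hg i j

/-- Integral of the product of two tree sums joined by the edge `ij`, the position of the
root `r` being fixed. -/
lemma lmarginal_joined_treeSum_le (hg : Measurable g) {A B : Finset α} (hAB : Disjoint A B)
    {r i j : α} (hr : r ∈ A) (hi : i ∈ A) (hj : j ∈ B) {cA cB : ℝ≥0∞}
    (hcA : ∀ x : α → E3, (∫⋯∫⁻_A.erase r, (fun x => (treeSum (distWeight g x) A : ℝ≥0∞))
      ∂(fun _ => volume)) x ≤ cA)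
    (hcB : ∀ x : α → E3, (∫⋯∫⁻_B.erase j, (fun x => (treeSum (distWeight g x) B : ℝ≥0∞))
      ∂(fun _ => volume)) x ≤ cB) (x : α → E3) :
    (∫⋯∫⁻_(A ∪ B).erase r, (fun x => (distWeight g x s(i, j) : ℝ≥0∞) *
      ((treeSum (distWeight g x) A : ℝ≥0∞) * (treeSum (distWeight g x) B : ℝ≥0∞)))
      ∂(fun _ => volume)) x ≤ cA * cB * ∫⁻ z : E3, (g ‖z‖ : ℝ≥0∞) := by
  have hmA := (measurable_treeSum_distWeight hg A).coe_nnreal_ennreal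
  have hmB := (measurable_treeSum_distWeight hg B).coe_nnreal_ennreal
  have hmw := (measurable_distWeight hg i j).coe_nnreal_ennreal
  have hrB : r ∉ B := Finset.disjoint_left.1 hAB hr
  have hjA : j ∉ A := Finset.disjoint_right.1 hAB hj
  have hiB : i ∉ B := Finset.disjoint_left.1 hAB hi
  have hset : (A ∪ B).erase r = A.erase r ∪ ({j} ∪ B.erase j) := by
    rw [Finset.erase_union_distrib, Finset.erase_eq_of_notMem hrB, ← Finset.insert_eq,
      Finset.insert_erase hj]
  have hd1 : Disjoint (A.erase r) ({j} ∪ B.erase j) := by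
    rw [← Finset.insert_eq, Finset.insert_erase hj]
    exact hAB.mono_left (Finset.erase_subset _ _)
  have hd2 : Disjoint ({j} : Finset α) (B.erase j) := by simp
  have hmeas : Measurable fun x : α → E3 => (distWeight g x s(i, j) : ℝ≥0∞) *
      ((treeSum (distWeight g x) A : ℝ≥0∞) * (treeSum (distWeight g x) B : ℝ≥0∞)) :=
    hmw.mul (hmA.mul hmB)
  rw [hset, lmarginal_union _ _ hmeas hd1, lmarginal_union _ _ hmeas hd2]
  have hinner : (∫⋯∫⁻_B.erase j, (fun x => (distWeight g x s(i, j) : ℝ≥0∞) *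
      ((treeSum (distWeight g x) A : ℝ≥0∞) * (treeSum (distWeight g x) B : ℝ≥0∞)))
      ∂(fun _ => volume)) ≤ fun x : α → E3 =>
      ((treeSum (distWeight g x) A : ℝ≥0∞) * cB) * (distWeight g x s(i, j) : ℝ≥0∞) := by
    intro x
    have h := lmarginal_mul_left_of_congr (fun _ : α => (volume : Measure E3)) (s := B.erase j)
      (φ := fun x => (distWeight g x s(i, j) : ℝ≥0∞) * (treeSum (distWeight g x) A : ℝ≥0∞))
      (fun x y hxy => ?_) hmB x
    · simp only [← mul_assoc]
      rw [h, mul_comm (distWeight g x s(i, j) : ℝ≥0∞), mul_assoc, mul_assoc,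
        mul_comm cB]
      gcongr
      exact hcB x
    · have h1 : x i = y i := hxy i fun h => hiB (Finset.mem_of_mem_erase h)
      have h2 : x j = y j := hxy j (Finset.notMem_erase _ _)
      simp only [distWeight_mk, h1, h2]
      rw [treeSum_distWeight_congr fun k hk => hxy k fun h =>
        Finset.disjoint_left.1 hAB hk (Finset.mem_of_mem_erase h)]
  have hedge : (∫⋯∫⁻_{j}, (fun x : α → E3 =>
      ((treeSum (distWeight g x) A : ℝ≥0∞) * cB) * (distWeight g x s(i, j) : ℝ≥0∞))
      ∂(fun _ => volume)) = fun x : α → E3 =>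
      (cB * ∫⁻ z : E3, (g ‖z‖ : ℝ≥0∞)) * (treeSum (distWeight g x) A : ℝ≥0∞) := by
    ext x
    rw [lmarginal_mul_left_of_congr (fun _ : α => (volume : Measure E3)) (fun x y hxy => ?_) hmw x,
      lmarginal_singleton]
    · have hij : i ≠ j := fun h => hjA (h ▸ hi)
      simp only [distWeight_mk, Function.update_self, Function.update_of_ne hij]
      rw [lintegral_sub_left_eq_self (fun z : E3 => (g ‖z‖ : ℝ≥0∞)) (x i)]
      ring
    · rw [treeSum_distWeight_congr fun k hk => hxy k fun h =>
        hjA (Finset.mem_singleton.1 h ▸ hk)]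
  calc _ ≤ (∫⋯∫⁻_A.erase r, (fun x : α → E3 =>
      (cB * ∫⁻ z : E3, (g ‖z‖ : ℝ≥0∞)) * (treeSum (distWeight g x) A : ℝ≥0∞))
      ∂(fun _ => volume)) x := by
        rw [← hedge]
        exact lmarginal_mono (lmarginal_mono hinner) x
    _ = (cB * ∫⁻ z : E3, (g ‖z‖ : ℝ≥0∞)) * (∫⋯∫⁻_A.erase r, (fun x : α → E3 =>
        (treeSum (distWeight g x) A : ℝ≥0∞)) ∂(fun _ => volume)) x :=
        lmarginal_mul_left_of_congr (fun _ : α => (volume : Measure E3)) (fun _ _ _ => rfl) hmA x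
    _ ≤ (cB * ∫⁻ z : E3, (g ‖z‖ : ℝ≥0∞)) * cA := by gcongr; exact hcA x
    _ = _ := by ring

lemma sum_powerset_card_mul_pow_sub_two {S : Finset α} (hS : S.Nonempty) :
    ∑ A ∈ S.powerset, A.card * (S \ A).card *
      (A.card ^ (A.card - 2) * (S \ A).card ^ ((S \ A).card - 2)) =
      2 * (S.card - 1) * S.card ^ (S.card - 2) := by
  rw [← sum_choose_mul_pow_sub_two _ (Finset.card_pos.2 hS)]
  have := Finset.sum_powerset_apply_card (fun k => (k * k ^ (k - 2)) *
    ((S.card - k) * (S.card - k) ^ (S.card - k - 2))) (x := S)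
  simp only [smul_eq_mul] at this
  rw [← this]
  refine Finset.sum_congr rfl fun A hA => ?_
  rw [Finset.card_sdiff_of_subset (Finset.mem_powerset.1 hA)]
  ring

lemma lmarginal_treeSum_le (hg : Measurable g) (S : Finset α) {r : α} (hr : r ∈ S)
    (x : α → E3) :
    (∫⋯∫⁻_S.erase r, (fun x => (treeSum (distWeight g x) S : ℝ≥0∞)) ∂(fun _ => volume)) x ≤
      ((S.card ^ (S.card - 2) : ℕ) : ℝ≥0∞) * (∫⁻ z : E3, (g ‖z‖ : ℝ≥0∞)) ^ (S.card - 1) := by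
  induction S using Finset.strongInduction generalizing r x with
  | H S ih =>
    by_cases hS : S.card = 1
    · obtain ⟨i, rfl⟩ := Finset.card_eq_one.1 hS
      obtain rfl : r = i := by simpa using hr
      simp [treeSum_of_card_eq_one _ hS]
    set K := ∫⁻ z : E3, (g ‖z‖ : ℝ≥0∞) with hK
    have hcard : 2 ≤ S.card := by
      have := Finset.card_pos.2 ⟨r, hr⟩
      omega
    have hne : ((2 * (S.card - 1) : ℕ) : ℝ≥0∞) ≠ 0 := by
      rw [Nat.cast_ne_zero]; omega
    rw [← ENNReal.mul_le_mul_iff_right hne (ENNReal.natCast_ne_top _)]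
    have hmS := (measurable_treeSum_distWeight hg S).coe_nnreal_ennreal
    rw [← lmarginal_mul_left_of_congr (fun _ : α => (volume : Measure E3))
      (φ := fun _ => ((2 * (S.card - 1) : ℕ) : ℝ≥0∞)) (fun _ _ _ => rfl) hmS x]
    have hexp : ∀ x : α → E3,
        ((2 * (S.card - 1) : ℕ) : ℝ≥0∞) * (treeSum (distWeight g x) S : ℝ≥0∞) =
        ∑ A ∈ S.powerset, ∑ i ∈ A, ∑ j ∈ S \ A, (distWeight g x s(i, j) : ℝ≥0∞) *
          ((treeSum (distWeight g x) A : ℝ≥0∞) * (treeSum (distWeight g x) (S \ A) : ℝ≥0∞)) := by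
      intro x
      have h := congrArg ((↑) : NNReal → ℝ≥0∞)
        (two_mul_card_sub_one_mul_treeSum (distWeight g x) S)
      simp only [crossWeight, Finset.sum_mul] at h
      push_cast at h ⊢
      exact h
    have hterm : ∀ A ∈ S.powerset, ∀ i ∈ A, ∀ j ∈ S \ A,
        (∫⋯∫⁻_S.erase r, (fun x => (distWeight g x s(i, j) : ℝ≥0∞) *
          ((treeSum (distWeight g x) A : ℝ≥0∞) * (treeSum (distWeight g x) (S \ A) : ℝ≥0∞)))
          ∂(fun _ => volume)) x ≤
        ((A.card ^ (A.card - 2) * (S \ A).card ^ ((S \ A).card - 2) : ℕ) : ℝ≥0∞) *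
          K ^ (S.card - 1) := by
      intro A hA i hi j hj
      rw [Finset.mem_powerset] at hA
      have hlt : A ⊂ S := hA.ssubset_of_ne fun h => by simp [h] at hj
      have hlt' : S \ A ⊂ S := Finset.sdiff_ssubset hA ⟨i, hi⟩
      have hpow : K ^ (S.card - 1) = K ^ (A.card - 1) * K ^ ((S \ A).card - 1) * K := by
        rw [← pow_add, ← pow_succ]
        have h1 := Finset.card_pos.2 ⟨i, hi⟩
        have h2 := Finset.card_pos.2 ⟨j, hj⟩
        have h3 := Finset.card_sdiff_add_card_eq_card hA
        congr 1
        omega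
      by_cases hrA : r ∈ A
      · have h := lmarginal_joined_treeSum_le hg Finset.disjoint_sdiff hrA hi hj
          (ih A hlt hrA) (ih _ hlt' hj) x
        rw [Finset.union_sdiff_of_subset hA] at h
        refine h.trans_eq ?_
        rw [hpow]; push_cast; ring
      · have hrB : r ∈ S \ A := Finset.mem_sdiff.2 ⟨hr, hrA⟩
        have h := lmarginal_joined_treeSum_le hg Finset.sdiff_disjoint hrB hj hi
          (ih _ hlt' hrB) (ih A hlt hi) x
        rw [Finset.sdiff_union_of_subset hA, Sym2.eq_swap] at h
        simp only [mul_comm (treeSum (distWeight g _) (S \ A) : ℝ≥0∞)] at h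
        refine h.trans_eq ?_
        rw [hpow]; push_cast; ring
    have hmeas : ∀ (A B : Finset α) (i j : α), Measurable fun x : α → E3 =>
        (distWeight g x s(i, j) : ℝ≥0∞) *
          ((treeSum (distWeight g x) A : ℝ≥0∞) * (treeSum (distWeight g x) B : ℝ≥0∞)) :=
      fun A B i j => (measurable_distWeight hg i j).coe_nnreal_ennreal.mul
        ((measurable_treeSum_distWeight hg A).coe_nnreal_ennreal.mul
          (measurable_treeSum_distWeight hg B).coe_nnreal_ennreal)
    simp only [hexp]
    calc _ = ∑ A ∈ S.powerset, ∑ i ∈ A, ∑ j ∈ S \ A,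
          (∫⋯∫⁻_S.erase r, (fun x => (distWeight g x s(i, j) : ℝ≥0∞) *
            ((treeSum (distWeight g x) A : ℝ≥0∞) * (treeSum (distWeight g x) (S \ A) : ℝ≥0∞)))
            ∂(fun _ => volume)) x := by
          unfold lmarginal
          have hm' : ∀ (A : Finset α) (i j : α), Measurable fun y : S.erase r → E3 =>
              (distWeight g (Function.updateFinset x (S.erase r) y) s(i, j) : ℝ≥0∞) *
                ((treeSum (distWeight g (Function.updateFinset x (S.erase r) y)) A : ℝ≥0∞) *
                (treeSum (distWeight g (Function.updateFinset x (S.erase r) y)) (S \ A) :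
                  ℝ≥0∞)) := fun A i j => (hmeas A (S \ A) i j).comp
            (measurable_updateFinset (s := S.erase r) (x := x))
          rw [lintegral_finsetSum _ fun A _ => Finset.measurable_fun_sum _ fun i _ =>
            Finset.measurable_fun_sum _ fun j _ => hm' A i j]
          refine Finset.sum_congr rfl fun A _ => ?_
          rw [lintegral_finsetSum _ fun i _ => Finset.measurable_fun_sum _ fun j _ => hm' A i j]
          refine Finset.sum_congr rfl fun i _ => ?_
          rw [lintegral_finsetSum _ fun j _ => hm' A i j]
      _ ≤ ∑ A ∈ S.powerset, ∑ i ∈ A, ∑ j ∈ S \ A,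
          ((A.card ^ (A.card - 2) * (S \ A).card ^ ((S \ A).card - 2) : ℕ) : ℝ≥0∞) *
            K ^ (S.card - 1) :=
          Finset.sum_le_sum fun A hA => Finset.sum_le_sum fun i hi => Finset.sum_le_sum fun j hj =>
            hterm A hA i hi j hj
      _ = ((∑ A ∈ S.powerset, A.card * (S \ A).card *
            (A.card ^ (A.card - 2) * (S \ A).card ^ ((S \ A).card - 2)) : ℕ) : ℝ≥0∞) *
            K ^ (S.card - 1) := by
          rw [Nat.cast_sum, Finset.sum_mul]
          refine Finset.sum_congr rfl fun A _ => ?_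
          simp only [Finset.sum_const, nsmul_eq_mul]
          push_cast
          ring
      _ = _ := by
          rw [sum_powerset_card_mul_pow_sub_two ⟨r, hr⟩, ← mul_assoc, ← Nat.cast_mul]

/-- Integral of the tree sum over the configurations in `Λ`. -/
lemma setLIntegral_treeSum_le [Fintype α] [Nonempty α] (hg : Measurable g) {Λ : Set E3}
    (hm : MeasurableSet Λ) :
    ∫⁻ x in Set.univ.pi fun _ : α => Λ, (treeSum (distWeight g x) Finset.univ : ℝ≥0∞) ≤
      volume Λ * (((Fintype.card α ^ (Fintype.card α - 2) : ℕ) : ℝ≥0∞) *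
        (∫⁻ z : E3, (g ‖z‖ : ℝ≥0∞)) ^ (Fintype.card α - 1)) := by
  obtain ⟨r⟩ := ‹Nonempty α›
  set c : ℝ≥0∞ := ((Fintype.card α ^ (Fintype.card α - 2) : ℕ) : ℝ≥0∞) *
        (∫⁻ z : E3, (g ‖z‖ : ℝ≥0∞)) ^ (Fintype.card α - 1) with hc
  have hmT := (measurable_treeSum_distWeight hg (Finset.univ : Finset α)).coe_nnreal_ennreal
  have hmi : Measurable fun x : α → E3 => Λ.indicator (fun _ => (1 : ℝ≥0∞)) (x r) :=
    (measurable_const.indicator hm).comp (measurable_pi_apply r)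
  have hmul : Measurable fun x : α → E3 => Λ.indicator (fun _ => (1 : ℝ≥0∞)) (x r) *
      (treeSum (distWeight g x) Finset.univ : ℝ≥0∞) := hmi.mul hmT
  calc _ ≤ ∫⁻ x : α → E3, Λ.indicator (fun _ => (1 : ℝ≥0∞)) (x r) *
        (treeSum (distWeight g x) Finset.univ : ℝ≥0∞) := by
        rw [← lintegral_indicator (MeasurableSet.univ_pi fun _ => hm)]
        refine lintegral_mono fun x => ?_
        by_cases hx : x ∈ Set.univ.pi fun _ : α => Λ
        · rw [Set.indicator_of_mem hx, Set.indicator_of_mem (hx r (Set.mem_univ r)), one_mul]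
        · rw [Set.indicator_of_notMem hx]; exact zero_le
    _ = (∫⋯∫⁻_{r}, (∫⋯∫⁻_Finset.univ.erase r, (fun x : α → E3 =>
          Λ.indicator (fun _ => (1 : ℝ≥0∞)) (x r) *
          (treeSum (distWeight g x) Finset.univ : ℝ≥0∞)) ∂(fun _ => volume))
          ∂(fun _ => volume)) 0 := by
        rw [volume_pi, lintegral_eq_lmarginal_univ 0, ← lmarginal_union _ _ hmul
          (by simp), ← Finset.insert_eq, Finset.insert_erase (Finset.mem_univ r)]
    _ ≤ (∫⋯∫⁻_{r}, (fun x : α → E3 => c * Λ.indicator (fun _ => (1 : ℝ≥0∞)) (x r))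
          ∂(fun _ => volume)) 0 := by
        refine lmarginal_mono (fun x => ?_) 0
        rw [lmarginal_mul_left_of_congr (fun _ : α => (volume : Measure E3)) (fun x y hxy => by
          rw [hxy r (Finset.notMem_erase _ _)]) hmT x, mul_comm]
        gcongr
        simpa [hc] using lmarginal_treeSum_le hg Finset.univ (Finset.mem_univ r) x
    _ = volume Λ * c := by
        rw [lmarginal_singleton]
        simp only [Function.update_self]
        rw [lintegral_const_mul _ (measurable_const.indicator hm), lintegral_indicator hm,
          setLIntegral_one, mul_comm]

end TreeIntegral

section MayerBound

open scoped ENNReal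

open scoped Classical in
lemma sum_connected_eq_connSum {α : Type*} [Fintype α] [DecidableEq α] [Nonempty α]
    (f : Sym2 α → ℝ) :
    ∑ g ∈ Finset.univ.filter (fun g : SimpleGraph α => g.Connected),
      ∏ e ∈ Finset.univ.filter (fun e : Sym2 α => e ∈ g.edgeSet), f e =
      connSum f Finset.univ := by
  unfold connSum
  refine Finset.sum_nbij' (fun g => Finset.univ.filter (fun e : Sym2 α => e ∈ g.edgeSet))
    (fun E => SimpleGraph.fromEdgeSet (E : Set (Sym2 α))) ?_ ?_ ?_ ?_ fun _ _ => rfl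
  · intro g hg
    rw [Finset.mem_filter] at hg
    rw [Finset.mem_filter, Finset.mem_powerset]
    refine ⟨fun e he => ?_, Finset.univ_nonempty, fun i _ j _ => ?_⟩
    · induction e with
      | h i j =>
        rw [Finset.mem_filter, SimpleGraph.mem_edgeSet] at he
        simp [mk_mem_edgesOn, he.2.ne]
    · simpa using hg.2.preconnected i j
  · intro E hE
    rw [Finset.mem_filter] at hE
    rw [Finset.mem_filter]
    exact ⟨Finset.mem_univ _, ⟨fun i j => hE.2.2 i (Finset.mem_univ _) j (Finset.mem_univ _)⟩⟩
  · intro g _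
    simp
  · intro E hE
    rw [Finset.mem_filter, Finset.mem_powerset] at hE
    ext e
    have hdiag : e ∈ E → ¬e.IsDiag := fun he => (Finset.mem_filter.1 (hE.1 he)).2
    simpa using hdiag

lemma sum_edgesOn {α : Type*} [LinearOrder α] (f : Sym2 α → ℝ) (S : Finset α) :
    ∑ e ∈ edgesOn S, f e =
      ∑ p ∈ Finset.univ.filter (fun p : Fin S.card × Fin S.card => p.1 < p.2),
        f s(S.orderEmbOfFin rfl p.1, S.orderEmbOfFin rfl p.2) := by
  symm
  refine Finset.sum_bij (fun p _ => s(S.orderEmbOfFin rfl p.1, S.orderEmbOfFin rfl p.2))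
    ?_ ?_ ?_ fun _ _ => rfl
  · intro p hp
    rw [Finset.mem_filter] at hp
    exact mk_mem_edgesOn.2 ⟨S.orderEmbOfFin_mem rfl _, S.orderEmbOfFin_mem rfl _, by
      simpa using hp.2.ne⟩
  · rintro ⟨a, b⟩ hp ⟨c, d⟩ hq h
    rw [Finset.mem_filter] at hp hq
    rw [Sym2.eq_iff] at h
    simp only [EmbeddingLike.apply_eq_iff_eq] at h
    rcases h with ⟨rfl, rfl⟩ | ⟨rfl, rfl⟩
    · rfl
    · exact absurd hp.2 (not_lt.2 (le_of_lt hq.2))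
  · intro e he
    induction e with
    | h i j =>
      obtain ⟨hi, hj, hij⟩ := mk_mem_edgesOn.1 he
      have hrange : ∀ k ∈ S, ∃ a, S.orderEmbOfFin rfl a = k := fun k hk => by
        have : k ∈ Set.range (S.orderEmbOfFin rfl) := by simpa using hk
        exact this
      obtain ⟨a, rfl⟩ := hrange i hi
      obtain ⟨b, rfl⟩ := hrange j hj
      rcases lt_or_gt_of_ne (fun h : a = b => hij (congrArg _ h)) with h | h
      · exact ⟨(a, b), by simpa using h, rfl⟩
      · exact ⟨(b, a), by simpa using h, Sym2.eq_swap⟩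

/-- The pair interactions of a configuration `x`, as a function of the edges. -/
def pairInteraction (V : ℝ → ℝ) {α : Type*} (x : α → E3) : Sym2 α → ℝ :=
  Sym2.lift ⟨fun i j => V ‖x i - x j‖, fun i j => by simp only [norm_sub_rev (x i)]⟩

lemma pairInteraction_mk (V : ℝ → ℝ) {α : Type*} (x : α → E3) (i j : α) :
    pairInteraction V x s(i, j) = V ‖x i - x j‖ := rfl

lemma IsStableWith.le_sum_edgesOn {Φ : ℝ → ℝ} {B : ℝ} (h : IsStableWith Φ B) {n : ℕ}
    (x : Fin n → E3) (S : Finset (Fin n)) :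
    -(B * S.card) ≤ ∑ e ∈ edgesOn S, pairInteraction Φ x e := by
  rw [sum_edgesOn]
  exact h.2 S.card fun i => x (S.orderEmbOfFin rfl i)

lemma ae_injective {ι : Type*} [Fintype ι] : ∀ᵐ x : ι → E3, Function.Injective x := by
  have key : ∀ i j : ι, i ≠ j → ∀ᵐ x : ι → E3, x i ≠ x j := by
    intro i j hij
    let L : (ι → E3) →ₗ[ℝ] E3 := LinearMap.proj (R := ℝ) (φ := fun _ : ι => E3) i - LinearMap.proj j
    have hL : LinearMap.ker L ≠ ⊤ := by
      classical
      intro h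
      obtain ⟨z, hz⟩ := exists_ne (0 : E3)
      have hmem : Pi.single i z ∈ LinearMap.ker L := h ▸ Submodule.mem_top
      simp [L, hij, hz] at hmem
    have h0 := Measure.addHaar_submodule (volume : Measure (ι → E3)) _ hL
    rw [ae_iff]
    convert h0 using 2
    ext x
    simp [L, sub_eq_zero]
  have hall : ∀ᵐ x : ι → E3, ∀ i j, i ≠ j → x i ≠ x j := by
    rw [ae_all_iff]
    intro i
    rw [ae_all_iff]
    intro j
    by_cases hij : i = j
    · simp [hij]
    · filter_upwards [key i j hij] with x hx _ using hx
  filter_upwards [hall] with x hx i j hij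
  by_contra hne
  exact hx i j hne hij

/-- The Mayer bond weight `1 - exp (-|v|)`. -/
def bondWeight (v : ℝ) : NNReal := Real.toNNReal (1 - exp (-|v|))

lemma coe_bondWeight (v : ℝ) : (bondWeight v : ℝ) = 1 - exp (-|v|) :=
  Real.coe_toNNReal _ (by simp)

lemma measurable_bondWeight : Measurable bondWeight := by
  unfold bondWeight
  fun_prop

lemma bondWeight_add_le {a : ℝ} (ha : 0 ≤ a) (b : ℝ) :
    (bondWeight (a + b) : ℝ) ≤ |exp (-a) - 1| + |b| := by
  rw [coe_bondWeight]
  have h1 : exp (-a) * exp (-|b|) ≤ exp (-|a + b|) := by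
    rw [← exp_add, exp_le_exp]
    have := abs_add_le a b
    rw [abs_of_nonneg ha] at this
    linarith
  have h2 : exp (-a) ≤ 1 := by simpa using ha
  have h3 : 1 - |b| ≤ exp (-|b|) := by linarith [add_one_le_exp (-|b|)]
  have h4 : exp (-|b|) ≤ 1 := by simp
  rw [abs_of_nonpos (sub_nonpos.2 h2)]
  nlinarith [mul_nonneg (sub_nonneg.2 h2) (sub_nonneg.2 h4)]

lemma abs_connSum_pairInteraction_le {Φ₁ Φ₂ : ℝ → ℝ} (h₁pos : ∀ r : ℝ, 0 < r → 0 ≤ Φ₁ r)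
    {B : ℝ} (hB : IsStableWith Φ₂ B) {β : ℝ} (hβ : 0 < β) {n : ℕ} {x : Fin n → E3}
    (hx : Function.Injective x) :
    |connSum (fun e => exp (-(β * pairInteraction (fun r => Φ₁ r + Φ₂ r) x e)) - 1) Finset.univ| ≤
      exp (β * B * n) *
        treeSum (distWeight (fun r => bondWeight (β * (Φ₁ r + Φ₂ r))) x) Finset.univ := by
  have h := abs_connSum_le (α := Fin n)
    (v := fun e => β * pairInteraction (fun r => Φ₁ r + Φ₂ r) x e)
    (w := distWeight (fun r => bondWeight (β * (Φ₁ r + Φ₂ r))) x) (B := β * B) ?_ ?_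
  · simpa using h
  · intro e
    induction e with
    | h i j => rw [distWeight_mk, coe_bondWeight, pairInteraction_mk]
  · intro S
    rw [← Finset.mul_sum, mul_assoc, ← mul_neg]
    refine mul_le_mul_of_nonneg_left ((hB.le_sum_edgesOn x S).trans ?_) hβ.le
    refine Finset.sum_le_sum fun e he => ?_
    induction e with
    | h i j =>
      rw [pairInteraction_mk, pairInteraction_mk]
      have hij := (mk_mem_edgesOn.1 he).2.2
      have hpos : 0 < ‖x i - x j‖ := norm_pos_iff.2 (sub_ne_zero.2 (hx.ne hij))
      linarith [h₁pos _ hpos]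

lemma mayerCoeff_eq (V : ℝ → ℝ) (β : ℝ) (Λ : Set E3) {n : ℕ} (hn : n ≠ 0) :
    mayerCoeff V β Λ n = (volume Λ).toReal⁻¹ * (n.factorial : ℝ)⁻¹ *
      ∫ x : Fin n → E3 in Set.univ.pi fun _ => Λ,
        connSum (fun e => exp (-(β * pairInteraction V x e)) - 1) Finset.univ := by
  have : Nonempty (Fin n) := Fin.pos_iff_nonempty.1 (Nat.pos_of_ne_zero hn)
  unfold mayerCoeff
  congr 2
  funext x
  rw [← sum_connected_eq_connSum]
  refine Finset.sum_congr rfl fun g _ => Finset.prod_congr rfl fun e _ => ?_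
  induction e with
  | h i j => rw [pairInteraction_mk, Sym2.lift_mk, ← neg_mul]

lemma integrable_mayerBound {Φ₁ Φ₂ : ℝ → ℝ} (hV : Measurable (fun r => Φ₁ r + Φ₂ r))
    (h₁pos : ∀ r : ℝ, 0 < r → 0 ≤ Φ₁ r) (h₁temp : IsTempered Φ₁)
    (h₂int : Integrable (fun x : E3 => Φ₂ ‖x‖)) {β : ℝ} (hβ : 0 < β) :
    Integrable fun x : E3 => |exp (-β * Φ₁ ‖x‖) - 1| + β * |Φ₂ ‖x‖| := by
  refine Integrable.add ?_ (h₂int.abs.const_mul β)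
  have hmeas : AEStronglyMeasurable fun x : E3 => Φ₁ ‖x‖ := by
    have h := (hV.comp (measurable_norm (α := E3))).aestronglyMeasurable.sub
      (μ := volume) h₂int.aestronglyMeasurable
    refine h.congr (Filter.Eventually.of_forall fun x => ?_)
    simp
  have hmeas' : AEStronglyMeasurable fun x : E3 => |exp (-β * Φ₁ ‖x‖) - 1| := by
    have hc : Continuous fun t : ℝ => |exp (-β * t) - 1| := by fun_prop
    exact hc.comp_aestronglyMeasurable hmeas
  obtain ⟨r₀, hr₀, htemp⟩ := h₁temp
  have hpos : ∀ᵐ x : E3, 0 ≤ Φ₁ ‖x‖ := by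
    filter_upwards [Measure.ae_ne volume (0 : E3)] with x hx
    exact h₁pos _ (norm_pos_iff.2 hx)
  have hball : IntegrableOn (fun x : E3 => |exp (-β * Φ₁ ‖x‖) - 1|) (Metric.ball 0 r₀) := by
    refine Measure.integrableOn_of_bounded (M := 1) measure_ball_lt_top.ne hmeas' ?_
    filter_upwards [ae_restrict_of_ae hpos] with x hx
    have h1 : exp (-β * Φ₁ ‖x‖) ≤ 1 := by rw [exp_le_one_iff]; nlinarith
    rw [norm_eq_abs, abs_abs, abs_le]
    constructor <;> linarith [exp_pos (-β * Φ₁ ‖x‖)]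
  have hfar : IntegrableOn (fun x : E3 => |exp (-β * Φ₁ ‖x‖) - 1|) {x | r₀ ≤ ‖x‖} := by
    refine (htemp.const_mul β).mono' hmeas'.restrict ?_
    filter_upwards [ae_restrict_of_ae hpos] with x hx
    have h1 : exp (-β * Φ₁ ‖x‖) ≤ 1 := by rw [exp_le_one_iff]; nlinarith
    rw [norm_eq_abs, abs_abs, abs_of_nonpos (by linarith), abs_of_nonneg hx]
    linarith [add_one_le_exp (-β * Φ₁ ‖x‖)]
  rw [← integrableOn_univ]
  refine (hball.union hfar).mono_set fun x _ => ?_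
  rcases lt_or_ge ‖x‖ r₀ with h | h
  · exact Or.inl (by simpa using h)
  · exact Or.inr h

lemma lintegral_bondWeight_le {Φ₁ Φ₂ : ℝ → ℝ} (hV : Measurable (fun r => Φ₁ r + Φ₂ r))
    (h₁pos : ∀ r : ℝ, 0 < r → 0 ≤ Φ₁ r) (h₁temp : IsTempered Φ₁)
    (h₂int : Integrable (fun x : E3 => Φ₂ ‖x‖)) {β : ℝ} (hβ : 0 < β) :
    ∫⁻ x : E3, (bondWeight (β * (Φ₁ ‖x‖ + Φ₂ ‖x‖)) : ℝ≥0∞) ≤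
      ENNReal.ofReal (∫ x : E3, (|exp (-β * Φ₁ ‖x‖) - 1| + β * |Φ₂ ‖x‖|)) := by
  rw [ofReal_integral_eq_lintegral_ofReal (integrable_mayerBound hV h₁pos h₁temp h₂int hβ)
    (Filter.Eventually.of_forall fun x => by positivity)]
  refine lintegral_mono_ae ?_
  filter_upwards [Measure.ae_ne volume (0 : E3)] with x hx
  rw [← ENNReal.ofReal_coe_nnreal]
  refine ENNReal.ofReal_le_ofReal ?_
  have h := bondWeight_add_le (mul_nonneg hβ.le (h₁pos _ (norm_pos_iff.2 hx))) (β * Φ₂ ‖x‖)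
  rwa [← mul_add, abs_mul, abs_of_pos hβ, ← neg_mul] at h

end MayerBound

/-- Morais-Procacci-Scoppola: bound on the `n`-th Mayer coefficient
for a pair potential `V = Φ₁ + Φ₂` with `Φ₁ ≥ 0` tempered and `Φ₂` absolutely
integrable and stable with constant `B̃`. -/
theorem stmt7 (Φ₁ Φ₂ : ℝ → ℝ) (hV : Measurable (fun r => Φ₁ r + Φ₂ r))
    (h₁pos : ∀ r : ℝ, 0 < r → 0 ≤ Φ₁ r) (h₁temp : IsTempered Φ₁)
    (h₂int : Integrable (fun x : E3 => Φ₂ ‖x‖))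
    (Btil : ℝ) (hB : IsStableWith Φ₂ Btil)
    (β : ℝ) (hβ : 0 < β) (Λ : Set E3)
    (hbd : Bornology.IsBounded Λ) (hm : MeasurableSet Λ) (hΛ : 0 < volume Λ)
    (n : ℕ) (hn : 2 ≤ n) :
    |mayerCoeff (fun r => Φ₁ r + Φ₂ r) β Λ n| ≤
      Real.exp (β * Btil * n) * (n : ℝ) ^ (n - 2) *
        (∫ x : E3, (|Real.exp (-β * Φ₁ ‖x‖) - 1| + β * |Φ₂ ‖x‖|)) ^ (n - 1)
          / n.factorial := by
  have : Nonempty (Fin n) := Fin.pos_iff_nonempty.1 (by omega)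
  rw [mayerCoeff_eq _ _ _ (by omega)]
  set C := ∫ x : E3, (|Real.exp (-β * Φ₁ ‖x‖) - 1| + β * |Φ₂ ‖x‖|) with hC
  set I := ∫ x : Fin n → E3 in Set.univ.pi fun _ => Λ, connSum (fun e =>
    exp (-(β * pairInteraction (fun r => Φ₁ r + Φ₂ r) x e)) - 1) Finset.univ with hI
  have hC0 : 0 ≤ C := integral_nonneg fun x => by positivity
  have hfin : volume Λ ≠ ⊤ := hbd.measure_lt_top.ne
  have hvol : 0 < (volume Λ).toReal := ENNReal.toReal_pos hΛ.ne' hfin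
  have hg : Measurable fun r => bondWeight (β * (Φ₁ r + Φ₂ r)) :=
    measurable_bondWeight.comp (hV.const_mul β)
  have hbound : ‖I‖ₑ ≤ ENNReal.ofReal (exp (β * Btil * n) *
      ((volume Λ).toReal * ((n : ℝ) ^ (n - 2) * C ^ (n - 1)))) := by
    refine (enorm_integral_le_lintegral_enorm _).trans ?_
    calc _ ≤ ∫⁻ x in Set.univ.pi fun _ : Fin n => Λ, ENNReal.ofReal (exp (β * Btil * n)) *
          (treeSum (distWeight (fun r => bondWeight (β * (Φ₁ r + Φ₂ r))) x) Finset.univ :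
            ENNReal) := by
          refine lintegral_mono_ae ?_
          filter_upwards [ae_restrict_of_ae ae_injective] with x hx
          rw [← ofReal_norm, ← ENNReal.ofReal_coe_nnreal,
            ← ENNReal.ofReal_mul (exp_pos _).le, norm_eq_abs]
          exact ENNReal.ofReal_le_ofReal (abs_connSum_pairInteraction_le h₁pos hB hβ hx)
      _ ≤ ENNReal.ofReal (exp (β * Btil * n)) * (volume Λ * (((n ^ (n - 2) : ℕ) : ENNReal) *
          ENNReal.ofReal C ^ (n - 1))) := by
          rw [lintegral_const_mul' _ _ ENNReal.ofReal_ne_top]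
          refine mul_le_mul_right ((setLIntegral_treeSum_le hg hm).trans ?_) _
          rw [Fintype.card_fin]
          gcongr
          exact lintegral_bondWeight_le hV h₁pos h₁temp h₂int hβ
      _ = _ := by
          rw [ENNReal.ofReal_mul (exp_pos _).le, ENNReal.ofReal_mul hvol.le,
            ENNReal.ofReal_toReal hfin, ENNReal.ofReal_mul (by positivity),
            ENNReal.ofReal_pow hC0, ← Nat.cast_pow, ENNReal.ofReal_natCast]
  have habs : |I| ≤ exp (β * Btil * n) *
      ((volume Λ).toReal * ((n : ℝ) ^ (n - 2) * C ^ (n - 1))) := by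
    rw [← ofReal_norm, ENNReal.ofReal_le_ofReal_iff (by positivity)] at hbound
    exact hbound
  rw [abs_mul, abs_of_nonneg (by positivity)]
  calc _ ≤ (volume Λ).toReal⁻¹ * (n.factorial : ℝ)⁻¹ * (exp (β * Btil * n) *
      ((volume Λ).toReal * ((n : ℝ) ^ (n - 2) * C ^ (n - 1)))) := by gcongr
    _ = _ := by field_simp

end
end

section
/- Let 0 < a < 2^{-1/6}, let N ≥ 2, and let (x*_1,…,x*_N) be a minimum-energy configuration for the cut-off Lennard-Jones potential V_a. Then for every index i ∈ {1,…,N} one has W_a(i, x*) = Σ_{j≠i} V_a(|x*_i − x*_j|) < 0. -/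
open MeasureTheory Real

noncomputable section

/-- total interaction of particle `i` with the others -/
def Wtot (a : ℝ) {N : ℕ} (x : Fin N → E3) (i : Fin N) : ℝ :=
  ∑ j ∈ Finset.univ.erase i, Va a ‖x i - x j‖

/-- pair energy of the particles other than `i` -/
def energyWithout (V : ℝ → ℝ) {N : ℕ} (x : Fin N → E3) (i : Fin N) : ℝ :=
  ∑ p ∈ (Finset.univ.filter (fun p : Fin N × Fin N => p.1 < p.2)).filter
    (fun p => ¬(p.1 = i ∨ p.2 = i)), V ‖x p.1 - x p.2‖

theorem pairEnergy_eq_Wtot_add (a : ℝ) {N : ℕ} (x : Fin N → E3) (i : Fin N) :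
    pairEnergy (Va a) x = Wtot a x i + energyWithout (Va a) x i := by
  rw [pairEnergy, energyWithout, Wtot,
    ← Finset.sum_filter_add_sum_filter_not _ (fun p : Fin N × Fin N => p.1 = i ∨ p.2 = i)]
  congr 1
  symm
  refine Finset.sum_bij' (fun j _ => if i < j then (i, j) else (j, i))
    (fun p _ => if p.1 = i then p.2 else p.1) ?_ ?_ ?_ ?_ ?_
  · intro j hj
    have : j ≠ i := by simpa using hj
    by_cases h : i < j
    · simp [h]
    · simp [h]; omega
  · rintro ⟨p, q⟩ h
    simp only [Finset.mem_filter, Finset.mem_univ, true_and, Finset.mem_erase, and_true] at *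
    split_ifs <;> omega
  · intro j hj
    have : j ≠ i := by simpa using hj
    by_cases h : i < j <;> simp [h, this]
  · rintro ⟨p, q⟩ h
    simp only [Finset.mem_filter, Finset.mem_univ, true_and] at *
    obtain ⟨h, rfl | rfl⟩ := h
    · simp [h]
    · simp [h.ne, h.not_gt]
  · intro j _
    by_cases h : i < j
    · simp [h]
    · simp [h, norm_sub_rev (x i)]

theorem energyWithout_update (V : ℝ → ℝ) {N : ℕ} (x : Fin N → E3) (i : Fin N) (z : E3) :
    energyWithout V (Function.update x i z) i = energyWithout V x i := by
  refine Finset.sum_congr rfl fun p hp => ?_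
  have h := (Finset.mem_filter.mp hp).2
  push Not at h
  rw [Function.update_of_ne h.1, Function.update_of_ne h.2]

theorem Va_neg_of_one_lt {a r : ℝ} (ha : a < 1) (hr : 1 < r) : Va a r < 0 := by
  have h6 : 1 < r ^ 6 := one_lt_pow₀ hr (by norm_num)
  have h12 : r ^ 12 = r ^ 6 * r ^ 6 := by ring
  rw [Va, if_pos (ha.trans hr), VLJ, sub_neg, h12,
    div_lt_div_iff₀ (by positivity) (by positivity)]
  nlinarith

theorem exists_forall_one_lt_norm_sub {N : ℕ} (x : Fin N → E3) :
    ∃ z : E3, ∀ j, 1 < ‖z - x j‖ := by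
  obtain ⟨z, hz⟩ := NormedSpace.exists_lt_norm ℝ E3 (∑ j, ‖x j‖ + 1)
  refine ⟨z, fun j => ?_⟩
  have h₁ : ‖x j‖ ≤ ∑ j, ‖x j‖ :=
    Finset.single_le_sum (f := fun j => ‖x j‖) (fun _ _ => norm_nonneg _) (Finset.mem_univ j)
  have h₂ := norm_sub_norm_le z (x j)
  linarith

/-- in a minimum-energy configuration for `V_a` each particle has
negative total interaction with the others. -/
theorem stmt9 (a : ℝ) (ha : 0 < a) (ha' : a < (2 : ℝ) ^ (-(1 : ℝ) / 6))
    (N : ℕ) (hN : 2 ≤ N) (x : Fin N → E3) (hx : IsMinEnergy (Va a) x) :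
    ∀ i : Fin N, Wtot a x i < 0 := by
  intro i
  have ha1 : a < 1 := ha'.trans (Real.rpow_lt_one_of_one_lt_of_neg (by norm_num) (by norm_num))
  obtain ⟨z, hz⟩ := exists_forall_one_lt_norm_sub x
  have hmin := hx (Function.update x i z)
  rw [pairEnergy_eq_Wtot_add a x i, pairEnergy_eq_Wtot_add a (Function.update x i z) i,
    energyWithout_update] at hmin
  refine (le_of_add_le_add_right hmin).trans_lt (Finset.sum_neg (fun j hj => ?_) ?_)
  · rw [Function.update_self, Function.update_of_ne (Finset.ne_of_mem_erase hj)]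
    exact Va_neg_of_one_lt ha1 (hz j)
  · rw [← Finset.card_pos, Finset.card_erase_of_mem (Finset.mem_univ i), Finset.card_fin]
    omega

end
end
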